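/- Let γ be a generic smooth closed curve in ℝ³, let c be the number of crossings of π(γ), and let v be the number of double tangent lines of π(γ), i.e. the number of valence-four vertices of the graphic of γ. Then c ≤ v. -/

import Mathlib

open Real Set

noncomputable section

namespace KWidth

/-! ### Lines in the plane (equivalently, planes in `ℝ³` perpendicular to the `xy`-plane).
A triple `L = (a, b, c)` with `(a,b) ≠ (0,0)` represents the line `{a x + b y = c}` in `ℝ²`,
equivalently the vertical plane `{a x + b y = c}` in `ℝ³`. -/

def IsLine (L : ℝ × ℝ × ℝ) : Prop := (L.1, L.2.1) ≠ (0, 0)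

def lineSet (L : ℝ × ℝ × ℝ) : Set (ℝ × ℝ) := {p | L.1 * p.1 + L.2.1 * p.2 = L.2.2}

/-- The affine function whose zero set cuts out the line, evaluated along the curve. -/
def hFun (γ : ℝ → ℝ × ℝ) (L : ℝ × ℝ × ℝ) : ℝ → ℝ :=
  fun t => L.1 * (γ t).1 + L.2.1 * (γ t).2 - L.2.2

/-- Parameters (in one period) at which the curve meets the line. -/
def memParams (γ : ℝ → ℝ × ℝ) (L : ℝ × ℝ × ℝ) : Set ℝ :=
  {t | t ∈ Ico (0 : ℝ) 1 ∧ γ t ∈ lineSet L}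

/-- The width of a line: the number of intersection points with the closed curve `γ`
(of period one). -/
def lineWidth (γ : ℝ → ℝ × ℝ) (L : ℝ × ℝ × ℝ) : ℕ := Nat.card (memParams γ L)

/-- The line is transverse to the curve: at every intersection point the tangent line of the
curve is not contained in it. -/
def TransverseLine (γ : ℝ → ℝ × ℝ) (L : ℝ × ℝ × ℝ) : Prop :=
  IsLine L ∧ ∀ t : ℝ, γ t ∈ lineSet L → deriv (hFun γ L) t ≠ 0

/-- The line `L` is tangent to the curve at the parameter `t`. -/
def TangentAt (γ : ℝ → ℝ × ℝ) (L : ℝ × ℝ × ℝ) (t : ℝ) : Prop :=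
  IsLine L ∧ γ t ∈ lineSet L ∧ deriv (hFun γ L) t = 0

/-! ### Curvature of plane curves -/

def speed (γ : ℝ → ℝ × ℝ) (t : ℝ) : ℝ :=
  Real.sqrt ((deriv (fun s => (γ s).1) t) ^ 2 + (deriv (fun s => (γ s).2) t) ^ 2)

/-- Signed curvature of a regular plane curve (in an arbitrary regular parametrization). -/
def signedCurv (γ : ℝ → ℝ × ℝ) (t : ℝ) : ℝ :=
  (deriv (fun s => (γ s).1) t * deriv (deriv fun s => (γ s).2) t -
      deriv (fun s => (γ s).2) t * deriv (deriv fun s => (γ s).1) t) / speed γ t ^ 3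

/-- Total curvature of a closed plane curve of period one: the integral of the absolute value of
the curvature with respect to arc length. -/
def totalCurv (γ : ℝ → ℝ × ℝ) : ℝ := ∫ t in (0:ℝ)..1, |signedCurv γ t| * speed γ t

/-! ### Crossings, inflection points, double tangent lines -/

/-- `p` is a self-intersection (crossing) point of the closed curve `γ`. -/
def CrossingPt (γ : ℝ → ℝ × ℝ) (p : ℝ × ℝ) : Prop :=
  ∃ s ∈ Ico (0:ℝ) 1, ∃ t ∈ Ico (0:ℝ) 1, s ≠ t ∧ γ s = p ∧ γ t = p

def crossingCount (γ : ℝ → ℝ × ℝ) : ℕ := Nat.card {p | CrossingPt γ p}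

def inflectionParams (γ : ℝ → ℝ × ℝ) : Set ℝ := {t | t ∈ Ico (0:ℝ) 1 ∧ signedCurv γ t = 0}

def inflectionCount (γ : ℝ → ℝ × ℝ) : ℕ := Nat.card (inflectionParams γ)

/-- The set of points at which a given line is tangent to the curve. -/
def tangencyPts (γ : ℝ → ℝ × ℝ) (L : ℝ × ℝ × ℝ) : Set (ℝ × ℝ) :=
  {p | ∃ t ∈ Ico (0:ℝ) 1, TangentAt γ L t ∧ γ t = p}

/-- `L` is a double tangent line: it is tangent to the curve at exactly two points. -/
def IsDoubleTangent (γ : ℝ → ℝ × ℝ) (L : ℝ × ℝ × ℝ) : Prop :=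
  IsLine L ∧ ∃ p q : ℝ × ℝ, p ≠ q ∧ tangencyPts γ L = {p, q}

/-- A subset `ℓ ⊆ ℝ²` is a double tangent line of `γ`. -/
def IsDoubleTangentLine (γ : ℝ → ℝ × ℝ) (ℓ : Set (ℝ × ℝ)) : Prop :=
  ∃ L, lineSet L = ℓ ∧ IsDoubleTangent γ L

/-- An exterior double tangent line: the curve lies locally on the same side of the line at its
two points of tangency. -/
def IsExtDoubleTangentLine (γ : ℝ → ℝ × ℝ) (ℓ : Set (ℝ × ℝ)) : Prop :=
  ∃ L, lineSet L = ℓ ∧ IsDoubleTangent γ L ∧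
    ∃ s ∈ Ico (0:ℝ) 1, ∃ t ∈ Ico (0:ℝ) 1, γ s ≠ γ t ∧ TangentAt γ L s ∧ TangentAt γ L t ∧
      0 < deriv (deriv (hFun γ L)) s * deriv (deriv (hFun γ L)) t

/-- An interior double tangent line: the curve lies locally on opposite sides of the line at its
two points of tangency (the line separates neighborhoods of the tangency points). -/
def IsIntDoubleTangentLine (γ : ℝ → ℝ × ℝ) (ℓ : Set (ℝ × ℝ)) : Prop :=
  ∃ L, lineSet L = ℓ ∧ IsDoubleTangent γ L ∧
    ∃ s ∈ Ico (0:ℝ) 1, ∃ t ∈ Ico (0:ℝ) 1, γ s ≠ γ t ∧ TangentAt γ L s ∧ TangentAt γ L t ∧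
      deriv (deriv (hFun γ L)) s * deriv (deriv (hFun γ L)) t < 0

/-! ### Generic plane curves -/

/-- A generic (`C²`, immersed, closed) plane curve: finitely many self-intersections, all of them
transverse double points, finitely many inflection points, finitely many double tangent lines,
all of them nondegenerate, no line tangent to the curve at more than two points, and no tangent
line at an inflection point or double tangency passing through a crossing. -/
structure GenericPlane (γ : ℝ → ℝ × ℝ) : Prop where
  contDiff : ContDiff ℝ 2 γ
  periodic : Function.Periodic γ 1
  immersed : ∀ t, deriv γ t ≠ 0
  selfint_finite : {p : ℝ × ℝ | CrossingPt γ p}.Finite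
  crossings_transverse : ∀ s ∈ Ico (0:ℝ) 1, ∀ t ∈ Ico (0:ℝ) 1, s ≠ t → γ s = γ t →
    (deriv γ s).1 * (deriv γ t).2 - (deriv γ s).2 * (deriv γ t).1 ≠ 0
  no_triple_point : ∀ s ∈ Ico (0:ℝ) 1, ∀ t ∈ Ico (0:ℝ) 1, ∀ u ∈ Ico (0:ℝ) 1,
    γ s = γ t → γ t = γ u → s = t ∨ t = u ∨ s = u
  inflections_finite : (inflectionParams γ).Finite
  dbltangents_finite : {ℓ : Set (ℝ × ℝ) | IsDoubleTangentLine γ ℓ}.Finite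
  no_triple_tangent : ∀ L : ℝ × ℝ × ℝ, IsLine L → ∀ p ∈ tangencyPts γ L, ∀ q ∈ tangencyPts γ L,
    ∀ r ∈ tangencyPts γ L, p = q ∨ q = r ∨ p = r
  dbltangent_nondeg : ∀ L : ℝ × ℝ × ℝ, IsDoubleTangent γ L → ∀ t, TangentAt γ L t →
    deriv (deriv (hFun γ L)) t ≠ 0
  tangent_at_inflection_avoids_crossings : ∀ L : ℝ × ℝ × ℝ, ∀ t : ℝ, TangentAt γ L t →
    signedCurv γ t = 0 → ∀ p : ℝ × ℝ, CrossingPt γ p → p ∉ lineSet L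
  dbltangent_avoids_crossings : ∀ L : ℝ × ℝ × ℝ, IsDoubleTangent γ L →
    ∀ p : ℝ × ℝ, CrossingPt γ p → p ∉ lineSet L

/-! ### Equivalence classes of transverse lines and the 2-width -/

/-- Two lines are connected by a path of lines transverse to the curve `γ`. -/
def LineHomotopic (γ : ℝ → ℝ × ℝ) (L₀ L₁ : ℝ × ℝ × ℝ) : Prop :=
  ∃ P : ℝ → ℝ × ℝ × ℝ, ContinuousOn P (Icc 0 1) ∧ P 0 = L₀ ∧ P 1 = L₁ ∧
    ∀ s ∈ Icc (0:ℝ) 1, TransverseLine γ (P s)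

/-- The type of lines transverse to `γ`. -/
def TLine (γ : ℝ → ℝ × ℝ) := {L : ℝ × ℝ × ℝ // TransverseLine γ L}

def lineRel (γ : ℝ → ℝ × ℝ) : TLine γ → TLine γ → Prop :=
  fun L₀ L₁ => LineHomotopic γ L₀.val L₁.val

/-- Equivalence classes of lines transverse to `γ`. -/
def LineClasses (γ : ℝ → ℝ × ℝ) := Quot (lineRel γ)

/-- The 2-width of a closed plane curve: the sum, over the equivalence classes of transverse
lines, of the width of a representative line. -/
def w₂ (γ : ℝ → ℝ × ℝ) : ℕ := ∑ᶠ C : LineClasses γ, lineWidth γ (Quot.out C).val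

/-! ### Space curves -/

/-- Vertical projection `π : ℝ³ → ℝ²` applied to a space curve. -/
def proj (γ : ℝ → ℝ × ℝ × ℝ) : ℝ → ℝ × ℝ := fun t => ((γ t).1, (γ t).2.1)

/-- A smooth embedded closed curve in `ℝ³`, parametrized with period one. -/
def SmoothClosedCurve (γ : ℝ → ℝ × ℝ × ℝ) : Prop :=
  ContDiff ℝ (⊤ : ℕ∞) γ ∧ Function.Periodic γ 1 ∧ (∀ t, deriv γ t ≠ 0) ∧
    Set.InjOn γ (Ico (0:ℝ) 1)

/-- A generic smooth closed curve in `ℝ³`: smooth, embedded, no tangent line parallel to the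
`z`-axis, and the vertical projection is a generic plane curve. -/
def GenericSpace (γ : ℝ → ℝ × ℝ × ℝ) : Prop :=
  SmoothClosedCurve γ ∧ (∀ t, deriv (proj γ) t ≠ 0) ∧ GenericPlane (proj γ)

/-- A vertical plane `{a x + b y = c}` in `ℝ³` meets the curve `γ` exactly where the line
`{a x + b y = c}` in `ℝ²` meets `π(γ)`, and transversality/width agree; so the 2-width of a
space curve is the 2-width of its projection computed with lines in `ℝ²`. -/
def w₂Space (γ : ℝ → ℝ × ℝ × ℝ) : ℕ := w₂ (proj γ)

/-! ### Isotopy and knots -/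

/-- Smooth closed curves `γ₀, γ₁` in `ℝ³` are isotopic: one deforms to the other through smooth
embedded closed curves. -/
def Isotopic (γ₀ γ₁ : ℝ → ℝ × ℝ × ℝ) : Prop :=
  ∃ F : ℝ → ℝ → ℝ × ℝ × ℝ, Continuous (Function.uncurry F) ∧
    (∀ s ∈ Icc (0:ℝ) 1, SmoothClosedCurve (F s)) ∧ F 0 = γ₀ ∧ F 1 = γ₁

/-- The round unit circle in the `xy`-plane. -/
def roundCircle : ℝ → ℝ × ℝ × ℝ := fun t => (Real.cos (2 * π * t), Real.sin (2 * π * t), 0)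

/-- A curve is unknotted if it is isotopic to a round circle. -/
def Unknot (γ : ℝ → ℝ × ℝ × ℝ) : Prop := Isotopic γ roundCircle

/-- The `(p,q)`-torus curve on the standardly embedded torus in `ℝ³`, winding `p` times around
one generating circle and `q` times around the other. -/
def torusKnot (p q : ℤ) : ℝ → ℝ × ℝ × ℝ := fun t =>
  ((2 + Real.cos (2 * π * (q : ℝ) * t)) * Real.cos (2 * π * (p : ℝ) * t),
   (2 + Real.cos (2 * π * (q : ℝ) * t)) * Real.sin (2 * π * (p : ℝ) * t),
   Real.sin (2 * π * (q : ℝ) * t))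

/-- The 2-width of the knot (isotopy class) represented by `γ₀`: the minimum of the 2-widths of
its generic representatives. -/
def knotW2 (γ₀ : ℝ → ℝ × ℝ × ℝ) : ℕ :=
  sInf {w : ℕ | ∃ γ, GenericSpace γ ∧ Isotopic γ γ₀ ∧ w₂Space γ = w}

/-- Braid position: in cylindrical coordinates `γ(s) = (r(s), θ(s), z(s))` with `r > 0` and
`θ' > 0`. -/
def BraidPosition (γ : ℝ → ℝ × ℝ × ℝ) : Prop :=
  ∃ r θ z : ℝ → ℝ, ContDiff ℝ (⊤ : ℕ∞) r ∧ ContDiff ℝ (⊤ : ℕ∞) θ ∧ ContDiff ℝ (⊤ : ℕ∞) z ∧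
    (∀ t, 0 < r t) ∧ (∀ t, 0 < deriv θ t) ∧
    ∀ t, γ t = (r t * Real.cos (θ t), r t * Real.sin (θ t), z t)

/-! ### The space `X₂` as a topological space, the graphic, and the Möbius band -/

/-- Two parameter triples represent the same line iff they are proportional. -/
def lineSetoid : Setoid {L : ℝ × ℝ × ℝ // IsLine L} where
  r L L' := ∃ c : ℝ, c ≠ 0 ∧ L'.val = c • L.val
  iseqv := by
    refine ⟨fun L => ⟨1, one_ne_zero, (one_smul _ _).symm⟩, ?_, ?_⟩
    · rintro L M ⟨c, hc, h⟩
      exact ⟨c⁻¹, inv_ne_zero hc, by rw [h, smul_smul, inv_mul_cancel₀ hc, one_smul]⟩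
    · rintro L M N ⟨c, hc, h⟩ ⟨d, hd, h'⟩
      exact ⟨d * c, mul_ne_zero hd hc, by rw [h', h, smul_smul]⟩

/-- The space `X₂` of lines in the plane (equivalently, of planes in `ℝ³` perpendicular to the
`xy`-plane), an open Möbius band, with the quotient topology. -/
def X₂sp := Quotient lineSetoid

instance : TopologicalSpace X₂sp := instTopologicalSpaceQuotient

/-- The graphic of a curve: the set of all its tangent lines, as a subset of `X₂`. -/
def graphic (γ : ℝ → ℝ × ℝ) : Set X₂sp :=
  {x | ∃ L : {L : ℝ × ℝ × ℝ // IsLine L}, Quotient.mk lineSetoid L = x ∧ ∃ t : ℝ, TangentAt γ L.val t}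

/-- The set of lines (as points of `X₂`) that are *not* transverse to `γ`. -/
def nonTransverse (γ : ℝ → ℝ × ℝ) : Set X₂sp :=
  {x | ∃ L : {L : ℝ × ℝ × ℝ // IsLine L}, Quotient.mk lineSetoid L = x ∧ ¬ TransverseLine γ L.val}

/-- The standard open Möbius band: the quotient of `ℝ²` by `(x, y) ∼ (x + 1, -y)`. -/
def mobiusSetoid : Setoid (ℝ × ℝ) where
  r p q := ∃ k : ℤ, q.1 = p.1 + k ∧ q.2 = (-1 : ℝ) ^ k * p.2
  iseqv := by
    have hne : (-1 : ℝ) ≠ 0 := by norm_num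
    refine ⟨fun p => ⟨0, by simp⟩, ?_, ?_⟩
    · rintro p q ⟨k, h1, h2⟩
      refine ⟨-k, by rw [h1]; push_cast; ring, ?_⟩
      rw [h2, ← mul_assoc, ← zpow_add₀ hne]
      simp
    · rintro p q s ⟨k, h1, h2⟩ ⟨l, h3, h4⟩
      refine ⟨k + l, by rw [h3, h1]; push_cast; ring, ?_⟩
      rw [h4, h2, ← mul_assoc, ← zpow_add₀ hne, add_comm l k]

def MobiusBand := Quotient mobiusSetoid

instance : TopologicalSpace MobiusBand := instTopologicalSpaceQuotient

/-! ### Chords of a short arc with at most one inflection point -/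

/-- A continuous function without zeros on an interval keeps its sign. -/
lemma pos_of_ne_zero_on {K : ℝ → ℝ} (hK : Continuous K) {a b : ℝ}
    (hne : ∀ x ∈ uIcc a b, K x ≠ 0) (ha : 0 < K a) : 0 < K b := by
  by_contra! hb
  obtain ⟨x, hx, hx0⟩ := intermediate_value_uIcc (f := K) (a := a) (b := b) hK.continuousOn
    (show (0 : ℝ) ∈ uIcc (K a) (K b) from mem_uIcc.2 (Or.inr ⟨hb, ha.le⟩))
  exact hne x hx hx0

/-- If the curve `(u, v)` turns by less than a right angle between `s` and `t`, has at most one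
inflection point there, and has its tangent line at `s` passing through its point at `t`, then it
is curved at `s`, and if it turns left at `s`, its velocity at `t` points to the right of its
velocity at `s`. -/
lemma cross_velocity_neg {u u1 u2 v v1 v2 : ℝ → ℝ}
    (hu : ∀ x, HasDerivAt u (u1 x) x) (hu1 : ∀ x, HasDerivAt u1 (u2 x) x)
    (hv : ∀ x, HasDerivAt v (v1 x) x) (hv1 : ∀ x, HasDerivAt v1 (v2 x) x)
    (hK : Continuous fun x => u1 x * v2 x - v1 x * u2 x) {s t : ℝ} (hst : s < t)
    (hdot : ∀ x ∈ Icc s t, 0 < u1 s * u1 x + v1 s * v1 x)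
    (huniq : ∀ x ∈ Icc s t, ∀ y ∈ Icc s t, u1 x * v2 x - v1 x * u2 x = 0 →
      u1 y * v2 y - v1 y * u2 y = 0 → x = y)
    (hF : (u t - u s) * v1 s - (v t - v s) * u1 s = 0) :
    u1 s * v2 s - v1 s * u2 s ≠ 0 ∧
      (0 < u1 s * v2 s - v1 s * u2 s → u1 s * v1 t - v1 s * u1 t < 0) := by
  set K : ℝ → ℝ := fun x => u1 x * v2 x - v1 x * u2 x with hKdef
  have hss : s ∈ Icc s t := ⟨le_rfl, hst.le⟩
  set E : ℝ := u1 s ^ 2 + v1 s ^ 2 with hE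
  have hEpos : 0 < E := by have := hdot s hss; simp only [hE]; nlinarith
  set q : ℝ → ℝ := fun x => (u1 s * v1 x - v1 s * u1 x) / (u1 s * u1 x + v1 s * v1 x) with hq
  have hqd : ∀ x ∈ Icc s t,
      HasDerivAt q (E * K x / (u1 s * u1 x + v1 s * v1 x) ^ 2) x := by
    intro x hx
    have h1 := (((hv1 x).const_mul (u1 s)).sub ((hu1 x).const_mul (v1 s))).div
      (((hu1 x).const_mul (u1 s)).add ((hv1 x).const_mul (v1 s))) (hdot x hx).ne'
    refine h1.congr_deriv ?_
    congr 1
    simp only [hE, hKdef, Pi.add_apply, Pi.sub_apply]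
    ring
  have hqc : ContinuousOn q (Icc s t) := fun x hx => (hqd x hx).continuousAt.continuousWithinAt
  have hqs : q s = 0 := by simp only [hq]; rw [mul_comm (v1 s), sub_self, zero_div]
  have hq0 : ∀ x ∈ Icc s t, ∀ e, q x = e → u1 s * v1 x - v1 s * u1 x =
      e * (u1 s * u1 x + v1 s * v1 x) := by
    intro x hx e he
    rw [← he]
    exact (div_mul_cancel₀ _ (hdot x hx).ne').symm
  obtain ⟨x1, hx1, hY⟩ : ∃ x ∈ Ioo s t, u1 s * v1 x - v1 s * u1 x = 0 := by
    have hd : ∀ x, HasDerivAt (fun x => u1 s * v x - v1 s * u x) (u1 s * v1 x - v1 s * u1 x) x :=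
      fun x => ((hv x).const_mul _).sub ((hu x).const_mul _)
    refine exists_hasDerivAt_eq_zero hst (f := fun x => u1 s * v x - v1 s * u x)
      (fun x _ => (hd x).continuousAt.continuousWithinAt) ?_ fun x _ => hd x
    linear_combination hF
  have hqx1 : q x1 = 0 := by simp only [hq, hY, zero_div]
  obtain ⟨x2, hx2, hq2⟩ := exists_hasDerivAt_eq_zero hx1.1
    (hqc.mono (Icc_subset_Icc_right hx1.2.le)) (hqs.trans hqx1.symm)
    fun x hx => hqd x ⟨hx.1.le, hx.2.le.trans hx1.2.le⟩
  have hx2t : x2 < t := hx2.2.trans hx1.2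
  have hx2I : x2 ∈ Icc s t := ⟨hx2.1.le, hx2t.le⟩
  have hK2 : K x2 = 0 := by
    have := (hdot x2 hx2I).ne'
    have hE0 := hEpos.ne'
    simpa [this, hE0] using hq2
  have hneK : ∀ x ∈ Icc s t, x ≠ x2 → K x ≠ 0 := fun x hx hne h0 => hne (huniq x hx x2 hx2I h0 hK2)
  refine ⟨hneK s hss hx2.1.ne, fun hs => ?_⟩
  have hleft : ∀ x ∈ Ico s x2, 0 < K x := by
    intro x hx
    refine pos_of_ne_zero_on hK (a := s) (fun y hy => ?_) hs
    rw [uIcc_of_le hx.1] at hy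
    have : y < x2 := hy.2.trans_lt hx.2
    exact hneK y ⟨hy.1, (this.trans hx2t).le⟩ this.ne
  have hright : ∀ x ∈ Ioc x2 t, ∀ y ∈ Ioc x2 t, K y ≠ 0 := fun x _ y hy =>
    hneK y ⟨(hx2.1.trans hy.1).le, hy.2⟩ hy.1.ne'
  have hqd' : ∀ x ∈ Icc s t, deriv q x = E / (u1 s * u1 x + v1 s * v1 x) ^ 2 * K x := by
    intro x hx
    rw [(hqd x hx).deriv]
    ring
  have hcoef : ∀ x ∈ Icc s t, 0 < E / (u1 s * u1 x + v1 s * v1 x) ^ 2 := fun x hx =>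
    div_pos hEpos (pow_pos (hdot x hx) 2)
  have hsub1 : Icc s x2 ⊆ Icc s t := Icc_subset_Icc_right hx2t.le
  have hsub2 : Icc x2 t ⊆ Icc s t := Icc_subset_Icc_left hx2.1.le
  have hmono1 : StrictMonoOn q (Icc s x2) := by
    refine strictMonoOn_of_deriv_pos (convex_Icc _ _) (hqc.mono hsub1) fun x hx => ?_
    rw [interior_Icc] at hx
    have hx' := hsub1 ⟨hx.1.le, hx.2.le⟩
    rw [hqd' x hx']
    exact mul_pos (hcoef x hx') (hleft x ⟨hx.1.le, hx.2⟩)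
  have hposx2 : 0 < q x2 := by
    rw [← hqs]
    exact hmono1 ⟨le_rfl, hx2.1.le⟩ ⟨hx2.1.le, le_rfl⟩ hx2.1
  have htt : t ∈ Ioc x2 t := ⟨hx2t, le_rfl⟩
  have hKt : ∀ x ∈ Ioc x2 t, K x < 0 := by
    intro x hx
    by_contra! hxK
    have hxK' : 0 < K x := lt_of_le_of_ne hxK (hright t htt x hx).symm
    have hall : ∀ y ∈ Ioc x2 t, 0 < K y := fun y hy =>
      pos_of_ne_zero_on hK (a := x) (fun z hz => hright t htt z
        (ordConnected_Ioc.uIcc_subset hx hy hz)) hxK'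
    have hmono2 : StrictMonoOn q (Icc x2 t) := by
      refine strictMonoOn_of_deriv_pos (convex_Icc _ _) (hqc.mono hsub2) fun x hx => ?_
      rw [interior_Icc] at hx
      have hx' := hsub2 ⟨hx.1.le, hx.2.le⟩
      rw [hqd' x hx']
      exact mul_pos (hcoef x hx') (hall x ⟨hx.1, hx.2.le⟩)
    have := hmono2 ⟨le_rfl, hx2t.le⟩ ⟨hx2.2.le, hx1.2.le⟩ hx2.2
    linarith
  have hanti : StrictAntiOn q (Icc x2 t) := by
    refine strictAntiOn_of_deriv_neg (convex_Icc _ _) (hqc.mono hsub2) fun x hx => ?_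
    rw [interior_Icc] at hx
    have hx' := hsub2 ⟨hx.1.le, hx.2.le⟩
    rw [hqd' x hx']
    exact mul_neg_of_pos_of_neg (hcoef x hx') (hKt x ⟨hx.1, hx.2.le⟩)
  have hqt : q t < 0 := by
    rw [← hqx1]
    exact hanti ⟨hx2.2.le, hx1.2.le⟩ ⟨hx2t.le, le_rfl⟩ hx1.2
  have hti : t ∈ Icc s t := ⟨hst.le, le_rfl⟩
  rw [hq0 t hti (q t) rfl]
  exact mul_neg_of_neg_of_pos hqt (hdot t hti)

/-- On a short arc with at most one inflection point, if the tangent line at the initial point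
`s` passes through the end point `t`, then the two tangent determinants of the chord evolve
counterclockwise as the chord slides along the curve: initial point version. -/
lemma chord_initial_tangent {u u1 u2 v v1 v2 : ℝ → ℝ}
    (hu : ∀ x, HasDerivAt u (u1 x) x) (hu1 : ∀ x, HasDerivAt u1 (u2 x) x)
    (hv : ∀ x, HasDerivAt v (v1 x) x) (hv1 : ∀ x, HasDerivAt v1 (v2 x) x)
    (hK : Continuous fun x => u1 x * v2 x - v1 x * u2 x) {s t : ℝ} (hst : s < t)
    (hdot : ∀ x ∈ Icc s t, 0 < u1 s * u1 x + v1 s * v1 x)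
    (huniq : ∀ x ∈ Icc s t, ∀ y ∈ Icc s t, u1 x * v2 x - v1 x * u2 x = 0 →
      u1 y * v2 y - v1 y * u2 y = 0 → x = y)
    (hF : (u t - u s) * v1 s - (v t - v s) * u1 s = 0) :
    ((u t - u s) * v1 t - (v t - v s) * u1 t) *
      ((u1 t - u1 s) * v1 s + (u t - u s) * v2 s - (v1 t - v1 s) * u1 s - (v t - v s) * u2 s)
      < 0 := by
  have hss : s ∈ Icc s t := ⟨le_rfl, hst.le⟩
  have hEpos : 0 < u1 s ^ 2 + v1 s ^ 2 := by have := hdot s hss; nlinarith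
  have hX : 0 < u1 s * (u t - u s) + v1 s * (v t - v s) := by
    have hd : ∀ x, HasDerivAt (fun x => u1 s * u x + v1 s * v x) (u1 s * u1 x + v1 s * v1 x) x :=
      fun x => ((hu x).const_mul _).add ((hv x).const_mul _)
    have hm : StrictMonoOn (fun x => u1 s * u x + v1 s * v x) (Icc s t) := by
      refine strictMonoOn_of_deriv_pos (convex_Icc _ _)
        (fun x _ => (hd x).continuousAt.continuousWithinAt) fun x hx => ?_
      rw [(hd x).deriv]
      exact hdot x (interior_subset hx)
    have := hm hss ⟨hst.le, le_rfl⟩ hst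
    simp only at this
    linarith
  obtain ⟨l, hl, hD, hE⟩ : ∃ l : ℝ, 0 < l ∧ u t - u s = l * u1 s ∧ v t - v s = l * v1 s := by
    refine ⟨_, div_pos hX hEpos, ?_, ?_⟩
    · field_simp
      linear_combination v1 s * hF
    · field_simp
      linear_combination -u1 s * hF
  have hsign : (u1 s * v2 s - v1 s * u2 s) * (u1 s * v1 t - v1 s * u1 t) < 0 := by
    obtain ⟨hne, hpos⟩ := cross_velocity_neg hu hu1 hv hv1 hK hst hdot huniq hF
    rcases hne.lt_or_gt with h | h
    · have := (cross_velocity_neg hu hu1 (v := fun x => -v x) (v1 := fun x => -v1 x)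
        (v2 := fun x => -v2 x) (fun x => (hv x).neg) (fun x => (hv1 x).neg)
        (hK.neg.congr fun x => by simp only [Pi.neg_apply]; ring) hst
        (fun x hx => by simpa only [neg_mul_neg] using hdot x hx)
        (fun x hx y hy hx0 hy0 => huniq x hx y hy (by linarith) (by linarith))
        (by linear_combination -hF)).2 (by linarith)
      exact mul_neg_of_neg_of_pos h (by linarith)
    · exact mul_neg_of_pos_of_neg h (hpos h)
  rw [hD, hE]
  have hid : (l * u1 s * v1 t - l * v1 s * u1 t) *
      ((u1 t - u1 s) * v1 s + l * u1 s * v2 s - (v1 t - v1 s) * u1 s - l * v1 s * u2 s) =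
      l ^ 2 * ((u1 s * v2 s - v1 s * u2 s) * (u1 s * v1 t - v1 s * u1 t)) -
        l * (u1 s * v1 t - v1 s * u1 t) ^ 2 := by ring
  have h1 := mul_neg_of_pos_of_neg (pow_pos hl 2) hsign
  have h2 := mul_nonneg hl.le (sq_nonneg (u1 s * v1 t - v1 s * u1 t))
  linarith

/-- The end point version of `chord_initial_tangent`, obtained by reversing the curve. -/
lemma chord_final_tangent {u u1 u2 v v1 v2 : ℝ → ℝ}
    (hu : ∀ x, HasDerivAt u (u1 x) x) (hu1 : ∀ x, HasDerivAt u1 (u2 x) x)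
    (hv : ∀ x, HasDerivAt v (v1 x) x) (hv1 : ∀ x, HasDerivAt v1 (v2 x) x)
    (hK : Continuous fun x => u1 x * v2 x - v1 x * u2 x) {s t : ℝ} (hst : s < t)
    (hdot : ∀ x ∈ Icc s t, 0 < u1 t * u1 x + v1 t * v1 x)
    (huniq : ∀ x ∈ Icc s t, ∀ y ∈ Icc s t, u1 x * v2 x - v1 x * u2 x = 0 →
      u1 y * v2 y - v1 y * u2 y = 0 → x = y)
    (hG : (u t - u s) * v1 t - (v t - v s) * u1 t = 0) :
    0 < ((u t - u s) * v1 s - (v t - v s) * u1 s) *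
      ((u1 t - u1 s) * v1 t + (u t - u s) * v2 t - (v1 t - v1 s) * u1 t - (v t - v s) * u2 t) := by
  have hneg : ∀ {f f' : ℝ → ℝ}, (∀ x, HasDerivAt f (f' x) x) →
      ∀ x, HasDerivAt (fun x => f (-x)) (-f' (-x)) x := by
    intro f f' hf x
    exact ((hf (-x)).comp x (hasDerivAt_neg x)).congr_deriv (mul_neg_one _)
  have hmem : ∀ {x}, x ∈ Icc (-t) (-s) → -x ∈ Icc s t := fun hx =>
    ⟨le_neg_of_le_neg hx.2, neg_le_of_neg_le hx.1⟩
  have := chord_initial_tangent (u := fun x => u (-x)) (u1 := fun x => -u1 (-x))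
    (u2 := fun x => u2 (-x)) (v := fun x => v (-x)) (v1 := fun x => -v1 (-x))
    (v2 := fun x => v2 (-x)) (hneg hu) (fun x => (hneg hu1 x).neg.congr_deriv (neg_neg _)) (hneg hv)
    (fun x => (hneg hv1 x).neg.congr_deriv (neg_neg _))
    ((hK.comp continuous_neg).neg.congr fun x => by simp only [Pi.neg_apply, Function.comp_apply]; ring) (neg_lt_neg hst)
    (fun x hx => by simpa only [neg_mul_neg, neg_neg] using hdot (-x) (hmem hx))
    (fun x hx y hy hx0 hy0 => neg_injective (huniq _ (hmem hx) _ (hmem hy) (by linarith)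
      (by linarith)))
    (by simp only [neg_neg]; linear_combination hG)
  simp only [neg_neg] at this
  linarith

/-! ### Counting zeros of a planar map by an integral -/

section Degree

open MeasureTheory Topology

lemma det_prod_apply (L M : ℝ × ℝ →L[ℝ] ℝ) :
    (L.prod M).det = L (1, 0) * M (0, 1) - L (0, 1) * M (1, 0) := by
  rw [ContinuousLinearMap.det, ← LinearMap.det_toMatrix (Module.Basis.finTwoProd ℝ),
    Matrix.det_fin_two]
  simp [LinearMap.toMatrix_apply]

/-- Around a zero with nonvanishing Jacobian a `C¹` planar map is injective, and its Jacobian keeps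
its sign. -/
lemma exists_injOn_sign_det {Φ : ℝ × ℝ → ℝ × ℝ} (hΦ : ContDiff ℝ 1 Φ) {z : ℝ × ℝ}
    (hz : (fderiv ℝ Φ z).det ≠ 0) :
    ∃ U, IsOpen U ∧ z ∈ U ∧ InjOn Φ U ∧
      (∀ w ∈ U, SignType.sign (fderiv ℝ Φ w).det = SignType.sign (fderiv ℝ Φ z).det) ∧
      ∀ V ∈ 𝓝 z, Φ '' V ∈ 𝓝 (Φ z) := by
  have hstrict : HasStrictFDerivAt Φ
      (((fderiv ℝ Φ z).toContinuousLinearEquivOfDetNeZero hz : (ℝ × ℝ) ≃L[ℝ] (ℝ × ℝ)) :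
        ℝ × ℝ →L[ℝ] ℝ × ℝ) z := by
    simpa using hΦ.contDiffAt.hasStrictFDerivAt (by norm_num)
  have hcont : Continuous fun w => (fderiv ℝ Φ w).det :=
    ContinuousLinearMap.continuous_det.comp (hΦ.continuous_fderiv (by norm_num))
  have hsign : ∀ᶠ w in 𝓝 z,
      SignType.sign (fderiv ℝ Φ w).det = SignType.sign (fderiv ℝ Φ z).det := by
    have := (continuousAt_sign_of_ne_zero hz).comp (f := fun w => (fderiv ℝ Φ w).det)
      hcont.continuousAt
    exact this.tendsto.eventually_mem (mem_nhds_discrete.2 (mem_singleton _))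
  obtain ⟨W, hW, hWo, hzW⟩ := eventually_nhds_iff.1 hsign
  let e := hstrict.toOpenPartialHomeomorph Φ
  refine ⟨e.source ∩ W, e.open_source.inter hWo, ⟨hstrict.mem_toOpenPartialHomeomorph_source, hzW⟩,
    e.injOn.mono inter_subset_left, fun w hw => hW w hw.2, fun V hV => ?_⟩
  rw [← hstrict.map_nhds_eq_of_equiv]
  exact Filter.image_mem_map hV

/-- Nondegenerate zeros of a `C¹` planar map in a compact set are finite in number. -/
lemma finite_zeros {Φ : ℝ × ℝ → ℝ × ℝ} (hΦ : ContDiff ℝ 1 Φ) {R : Set (ℝ × ℝ)} (hR : IsCompact R)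
    (hdet : ∀ z ∈ R, Φ z = 0 → (fderiv ℝ Φ z).det ≠ 0) : {z | z ∈ R ∧ Φ z = 0}.Finite := by
  have hc : IsCompact {z | z ∈ R ∧ Φ z = 0} :=
    hR.inter_right (isClosed_singleton.preimage hΦ.continuous)
  choose! U hUo hzU hinj _ _ using fun z (hz : z ∈ {z | z ∈ R ∧ Φ z = 0}) =>
    exists_injOn_sign_det hΦ (hdet z hz.1 hz.2)
  obtain ⟨t, ht, hcov⟩ := hc.elim_nhds_subcover U fun z hz => (hUo z hz).mem_nhds (hzU z hz)
  refine t.finite_toSet.subset fun w hw => ?_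
  obtain ⟨z, hzt, hwz⟩ := mem_iUnion₂.1 (hcov hw)
  have hz := ht z hzt
  rw [hinj z hz hwz (hzU z hz) (hw.2.trans hz.2.symm)]
  exact hzt

/-- The signed count of nondegenerate zeros of a planar map in the interior of a rectangle is
computed by integrating the pullback of any form concentrated near the origin. -/
lemma integral_det_mul_comp {Φ : ℝ × ℝ → ℝ × ℝ} (hΦ : ContDiff ℝ 1 Φ) {a b : ℝ × ℝ}
    (hint : ∀ z ∈ Icc a b, Φ z = 0 → z ∈ interior (Icc a b))
    (hdet : ∀ z ∈ Icc a b, Φ z = 0 → (fderiv ℝ Φ z).det ≠ 0) (Z : Finset (ℝ × ℝ))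
    (hZ : ∀ z, z ∈ Z ↔ z ∈ Icc a b ∧ Φ z = 0) :
    ∃ δ > 0, ∀ h : ℝ × ℝ → ℝ, Continuous h → (∀ y, δ ≤ ‖y‖ → h y = 0) →
      ∫ z in Icc a b, (fderiv ℝ Φ z).det * h (Φ z) =
        (∑ z ∈ Z, ((SignType.sign (fderiv ℝ Φ z).det : SignType) : ℝ)) * ∫ y, h y := by
  choose! U hUo hzU hinj hsign himg using fun z (hz : z ∈ Z) =>
    exists_injOn_sign_det hΦ (hdet z ((hZ z).1 hz).1 ((hZ z).1 hz).2)
  obtain ⟨W, hW, hWd⟩ := Z.finite_toSet.t2_separation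
  set V : ℝ × ℝ → Set (ℝ × ℝ) := fun z => U z ∩ W z ∩ interior (Icc a b) with hV
  have hVo : ∀ z ∈ Z, IsOpen (V z) := fun z hz =>
    ((hUo z hz).inter (hW z).2).inter isOpen_interior
  have hzV : ∀ z ∈ Z, z ∈ V z := fun z hz =>
    ⟨⟨hzU z hz, (hW z).1⟩, hint z ((hZ z).1 hz).1 ((hZ z).1 hz).2⟩
  have hcont : Continuous fun w => (fderiv ℝ Φ w).det :=
    ContinuousLinearMap.continuous_det.comp (hΦ.continuous_fderiv (by norm_num))
  have hVR : ∀ z, V z ⊆ Icc a b := fun z => inter_subset_right.trans interior_subset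
  obtain ⟨m, hm, hmle⟩ : ∃ m > 0, ∀ w ∈ Icc a b \ ⋃ z ∈ Z, V z, m ≤ ‖Φ w‖ := by
    refine (isCompact_Icc.diff (isOpen_biUnion hVo)).exists_forall_le'
      hΦ.continuous.norm.continuousOn fun w hw => norm_pos_iff.2 fun h0 => hw.2 ?_
    have hwZ := (hZ w).2 ⟨hw.1, h0⟩
    exact mem_biUnion hwZ (hzV w hwZ)
  obtain ⟨d, hd, hdsub⟩ : ∃ d > 0, Metric.ball 0 d ⊆ ⋂ z ∈ Z, Φ '' V z := by
    refine Metric.mem_nhds_iff.1 ((Filter.biInter_finset_mem Z).2 fun z hz => ?_)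
    rw [← ((hZ z).1 hz).2]
    exact himg z hz _ ((hVo z hz).mem_nhds (hzV z hz))
  refine ⟨min m d, lt_min hm hd, fun h hh hsupp => ?_⟩
  have hfc : Continuous fun z => (fderiv ℝ Φ z).det * h (Φ z) := hcont.mul (hh.comp hΦ.continuous)
  have hmeas : MeasurableSet (Icc a b) := isClosed_Icc.measurableSet
  rw [setIntegral_eq_of_subset_of_forall_sdiff_eq_zero hmeas
    (iUnion₂_subset fun z _ => hVR z) fun w hw => by
      rw [hsupp _ ((min_le_left _ _).trans (hmle w hw)), mul_zero],
    integral_biUnion_finset Z (fun z hz => (hVo z hz).measurableSet)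
      (fun x hx y hy hxy => (hWd hx hy hxy).mono (fun w hw => hw.1.2) fun w hw => hw.1.2)
      fun z _ => (hfc.continuousOn.integrableOn_compact isCompact_Icc).mono_set (hVR z),
    Finset.sum_mul]
  refine Finset.sum_congr rfl fun z hz => ?_
  have hsub : V z ⊆ U z := fun w hw => hw.1.1
  have key := integral_image_eq_integral_abs_det_fderiv_smul volume (hVo z hz).measurableSet
    (fun w _ => (hΦ.differentiable (by norm_num) w).hasFDerivAt.hasFDerivWithinAt)
    ((hinj z hz).mono hsub) h
  rw [setIntegral_eq_integral_of_forall_compl_eq_zero fun y hy => hsupp y ?_] at key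
  · rw [key, ← integral_const_mul]
    refine setIntegral_congr_fun (hVo z hz).measurableSet fun w hw => ?_
    simp only [smul_eq_mul]
    rw [← hsign z hz w (hsub hw), ← mul_assoc, sign_mul_abs]
  · by_contra! hlt
    refine hy (mem_iInter₂.1 (hdsub ?_) z hz)
    rw [mem_ball_zero_iff]
    exact hlt.trans_le (min_le_right _ _)

/-- A `C¹` approximate Dirac mass together with its primitive. -/
lemma exists_bump {δ : ℝ} (hδ : 0 < δ) :
    ∃ b β : ℝ → ℝ, ContDiff ℝ 1 b ∧ (∀ x, 0 ≤ b x) ∧ (∀ x, δ ≤ |x| → b x = 0) ∧ ∫ x, b x = 1 ∧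
      (∀ x, HasDerivAt β (b x) x) ∧ (∀ x, 0 ≤ β x) ∧ ∀ x ≤ -δ, β x = 0 := by
  let f : ContDiffBump (0 : ℝ) := ⟨δ / 2, δ, half_pos hδ, half_lt_self hδ⟩
  have hz : ∀ x, δ ≤ |x| → f.normed volume x = 0 := by
    intro x hx
    have : x ∉ Function.support (f.normed volume) := by
      rw [f.support_normed_eq, mem_ball_zero_iff]
      exact not_lt.2 hx
    exact Function.notMem_support.1 this
  have hc : Continuous (f.normed volume) := f.continuous_normed
  have hβ0 : ∀ x ≤ -δ, ∫ y in (-δ)..x, f.normed volume y = 0 := by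
    intro x hx
    rw [intervalIntegral.integral_congr (g := fun _ => 0) fun y hy => ?_,
      intervalIntegral.integral_zero]
    rw [uIcc_of_ge hx] at hy
    exact hz y (le_abs.2 (Or.inr (le_neg_of_le_neg hy.2)))
  refine ⟨f.normed volume, fun x => ∫ y in (-δ)..x, f.normed volume y, f.contDiff_normed,
    fun x => f.nonneg_normed x, hz, f.integral_normed, fun x =>
    intervalIntegral.integral_hasDerivAt_right (hc.intervalIntegrable _ _)
      (hc.stronglyMeasurableAtFilter _ _) hc.continuousAt, fun x => ?_, hβ0⟩
  rcases le_total x (-δ) with h | h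
  · exact (hβ0 x h).ge
  · exact intervalIntegral.integral_nonneg h fun y _ => f.nonneg_normed y

/-- Green's theorem for the pullback of the one-form `β(x) b(y) dy` on a rectangle of width one,
under a planar map that is one-periodic in the first variable. -/
lemma integral_pullback_rect {F G : ℝ × ℝ → ℝ} (hF : ContDiff ℝ 2 F) (hG : ContDiff ℝ 2 G)
    (hFp : ∀ s r, F (s + 1, r) = F (s, r)) (hGp : ∀ s r, G (s + 1, r) = G (s, r))
    {b β : ℝ → ℝ} (hb : ContDiff ℝ 1 b) (hβ : ∀ x, HasDerivAt β (b x) x) {a c d : ℝ}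
    (hcd : c ≤ d) :
    ∫ z in Icc (a, c) (a + 1, d), (fderiv ℝ (fun w => (F w, G w)) z).det * (b (F z) * b (G z)) =
      (∫ s in a..(a + 1), β (F (s, c)) * b (G (s, c)) * fderiv ℝ G (s, c) (1, 0)) -
        ∫ s in a..(a + 1), β (F (s, d)) * b (G (s, d)) * fderiv ℝ G (s, d) (1, 0) := by
  have hFd : ∀ z, HasFDerivAt F (fderiv ℝ F z) z := fun z =>
    (hF.differentiable (by norm_num) z).hasFDerivAt
  have hGd : ∀ z, HasFDerivAt G (fderiv ℝ G z) z := fun z =>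
    (hG.differentiable (by norm_num) z).hasFDerivAt
  have hG1 : ContDiff ℝ 1 (fderiv ℝ G) := hG.fderiv_right (by norm_num)
  have hGv : ∀ v z, HasFDerivAt (fun w => fderiv ℝ G w v) ((fderiv ℝ (fderiv ℝ G) z).flip v) z := by
    intro v z
    have := (hG1.differentiable (by norm_num) z).hasFDerivAt
    simpa using this.clm_apply (hasFDerivAt_const v z)
  have hsymm : ∀ z, fderiv ℝ (fderiv ℝ G) z (1, 0) (0, 1) = fderiv ℝ (fderiv ℝ G) z (0, 1) (1, 0) :=
    fun z => (hG.contDiffAt.isSymmSndFDerivAt (by simp)).eq _ _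
  have hbd : ∀ x, HasDerivAt b (deriv b x) x := fun x =>
    (hb.differentiable (by norm_num) x).hasDerivAt
  have hform : ∀ v z, HasFDerivAt (fun w => β (F w) * b (G w) * fderiv ℝ G w v)
      ((β (F z) * b (G z)) • (fderiv ℝ (fderiv ℝ G) z).flip v + fderiv ℝ G z v •
        (β (F z) • deriv b (G z) • fderiv ℝ G z + b (G z) • b (F z) • fderiv ℝ F z)) z :=
    fun v z => (((hβ (F z)).comp_hasFDerivAt z (hFd z)).mul
      ((hbd (G z)).comp_hasFDerivAt z (hGd z))).mul (hGv v z)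
  have hfd : ∀ z, fderiv ℝ (fun w => (F w, G w)) z = (fderiv ℝ F z).prod (fderiv ℝ G z) :=
    fun z => ((hFd z).prodMk (hGd z)).fderiv
  have hFc := hF.continuous
  have hGc := hG.continuous
  have hbc := hb.continuous
  have hdF : Continuous (fderiv ℝ F) := hF.continuous_fderiv (by norm_num)
  have hdG : Continuous (fderiv ℝ G) := hG.continuous_fderiv (by norm_num)
  have hdiv : ∀ z, (fderiv ℝ (fun w => (F w, G w)) z).det * (b (F z) * b (G z)) =
      ((β (F z) * b (G z)) • (fderiv ℝ (fderiv ℝ G) z).flip (0, 1) + fderiv ℝ G z (0, 1) •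
        (β (F z) • deriv b (G z) • fderiv ℝ G z + b (G z) • b (F z) • fderiv ℝ F z)) (1, 0) +
      (-((β (F z) * b (G z)) • (fderiv ℝ (fderiv ℝ G) z).flip (1, 0) + fderiv ℝ G z (1, 0) •
        (β (F z) • deriv b (G z) • fderiv ℝ G z + b (G z) • b (F z) • fderiv ℝ F z))) (0, 1) := by
    intro z
    rw [hfd, det_prod_apply]
    simp only [add_apply, neg_apply, smul_apply,
      ContinuousLinearMap.flip_apply, smul_eq_mul, hsymm]
    ring
  have green := integral_divergence_prod_Icc_of_hasFDerivAt_of_le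
    (fun w => β (F w) * b (G w) * fderiv ℝ G w (0, 1))
    (fun w => -(β (F w) * b (G w) * fderiv ℝ G w (1, 0))) _ _ (a, c) (a + 1, d)
    ⟨(lt_add_one a).le, hcd⟩
    (fun z _ => (hform (0, 1) z).continuousAt.continuousWithinAt)
    (fun z _ => (hform (1, 0) z).neg.continuousAt.continuousWithinAt)
    (fun z _ => hform (0, 1) z) (fun z _ => (hform (1, 0) z).neg) (by
      simp only [← hdiv]
      refine Continuous.integrableOn_Icc ?_
      simp only [hfd, det_prod_apply]
      fun_prop)
  have hper : ∀ y, fderiv ℝ G (a + 1, y) = fderiv ℝ G (a, y) := by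
    intro y
    have h := fderiv_comp_add_right (𝕜 := ℝ) (f := G) (x := (a, y)) ((1 : ℝ), (0 : ℝ))
    have hG' : (fun z : ℝ × ℝ => G (z + (1, 0))) = G := by
      funext ⟨s, r⟩
      simpa using hGp s r
    rw [hG'] at h
    simpa using h.symm
  simp only [← hdiv] at green
  rw [green]
  simp only [hper, hFp, hGp, intervalIntegral.integral_neg]
  ring

/-- Along a periodic planar curve that crosses the positive first axis only counterclockwise, the
form `β(x) b(y) dy` concentrated near that axis has nonnegative integral. -/
lemma integral_near_axis_nonneg {f g g' : ℝ → ℝ} (hf : Continuous f) (hg : Continuous g)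
    (hg' : Continuous g') {a : ℝ} (h : ∀ s, g s = 0 → 0 < f s * g' s) :
    ∃ δ > 0, ∀ b β : ℝ → ℝ, (∀ x, 0 ≤ b x) → (∀ x, δ ≤ |x| → b x = 0) → (∀ x, 0 ≤ β x) →
      (∀ x ≤ -δ, β x = 0) → 0 ≤ ∫ s in a..(a + 1), β (f s) * b (g s) * g' s := by
  obtain ⟨δ, hδ, hmin⟩ : ∃ δ > 0, ∀ s ∈ Icc a (a + 1) ∩ {s | g' s ≤ 0}, δ ≤ max |g s| (-f s) := by
    refine (isCompact_Icc.inter_right (isClosed_le hg' continuous_const)).exists_forall_le'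
      (hg.abs.max hf.neg).continuousOn fun s hs => ?_
    by_cases h0 : g s = 0
    · refine lt_max_of_lt_right (neg_pos.2 ?_)
      by_contra! hf0
      exact absurd (h s h0) (not_lt.2 (mul_nonpos_of_nonneg_of_nonpos hf0 hs.2))
    · exact lt_max_of_lt_left (abs_pos.2 h0)
  refine ⟨δ, hδ, fun b β hb hb0 hβ hβ0 => intervalIntegral.integral_nonneg (lt_add_one a).le
    fun s hs => ?_⟩
  rcases le_total (g' s) 0 with hn | hn
  · rcases le_max_iff.1 (hmin s ⟨hs, hn⟩) with h1 | h1
    · rw [hb0 _ h1, mul_zero, zero_mul]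
    · rw [hβ0 _ (by linarith), zero_mul, zero_mul]
  · exact mul_nonneg (mul_nonneg (hβ _) (hb _)) hn

/-- If a planar map on an annulus turns counterclockwise along the bottom circle and clockwise along
the top circle, then its signed count of zeros is nonnegative. -/
lemma sum_sign_det_nonneg {F G : ℝ × ℝ → ℝ} (hF : ContDiff ℝ 2 F) (hG : ContDiff ℝ 2 G)
    (hFp : ∀ s r, F (s + 1, r) = F (s, r)) (hGp : ∀ s r, G (s + 1, r) = G (s, r))
    {a c d : ℝ} (hcd : c < d)
    (hbot : ∀ s, G (s, c) = 0 → 0 < F (s, c) * fderiv ℝ G (s, c) (1, 0))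
    (htop : ∀ s, G (s, d) = 0 → F (s, d) * fderiv ℝ G (s, d) (1, 0) < 0)
    (hside : ∀ r ∈ Icc c d, F (a, r) = 0 → G (a, r) ≠ 0)
    (hdet : ∀ z ∈ Icc (a, c) (a + 1, d), F z = 0 → G z = 0 →
      (fderiv ℝ (fun w => (F w, G w)) z).det ≠ 0) (Z : Finset (ℝ × ℝ))
    (hZ : ∀ z, z ∈ Z ↔ z ∈ Icc (a, c) (a + 1, d) ∧ F z = 0 ∧ G z = 0) :
    0 ≤ ∑ z ∈ Z, ((SignType.sign (fderiv ℝ (fun w => (F w, G w)) z).det : SignType) : ℝ) := by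
  have hΦ : ContDiff ℝ 1 fun w => (F w, G w) := (hF.prodMk hG).of_le (by norm_num)
  have hGs : ∀ r, Continuous fun s => fderiv ℝ G (s, r) (1, 0) := fun r =>
    ((hG.continuous_fderiv (by norm_num)).comp
      (by fun_prop : Continuous fun s : ℝ => (s, r))).clm_apply continuous_const
  have hsl : ∀ {f : ℝ × ℝ → ℝ}, ContDiff ℝ 2 f → ∀ r, Continuous fun s => f (s, r) :=
    fun hf r => hf.continuous.comp (by fun_prop)
  obtain ⟨δ₁, hδ₁, h₁⟩ := integral_near_axis_nonneg (a := a) (hsl hF c) (hsl hG c) (hGs c) hbot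
  obtain ⟨δ₂, hδ₂, h₂⟩ := integral_near_axis_nonneg (a := a) (hsl hF d) (hsl hG d) (hGs d).neg
    fun s hs => by
      rw [Pi.neg_apply, mul_neg]
      exact neg_pos.2 (htop s hs)
  obtain ⟨δ₃, hδ₃, h₃⟩ := integral_det_mul_comp hΦ (a := (a, c)) (b := (a + 1, d))
    (by
      rintro ⟨s, r⟩ ⟨⟨h1, h2⟩, h3, h4⟩ h0
      obtain ⟨hF0, hG0⟩ := Prod.mk_eq_zero.1 h0
      simp only at h1 h2 h3 h4
      have hne : ∀ {x}, x = c ∨ x = d → r ≠ x := by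
        rintro x hx rfl
        rcases hx with rfl | rfl
        · simpa [hF0] using hbot s hG0
        · simpa [hF0] using htop s hG0
      have hsa : s ≠ a := fun h => hside r ⟨h2, h4⟩ (h ▸ hF0) (h ▸ hG0)
      have hsa' : s ≠ a + 1 := by
        rintro rfl
        exact hside r ⟨h2, h4⟩ ((hFp a r).symm.trans hF0) ((hGp a r).symm.trans hG0)
      rw [Icc_prod_eq, interior_prod_eq, interior_Icc, interior_Icc]
      exact ⟨⟨lt_of_le_of_ne h1 hsa.symm, lt_of_le_of_ne h3 hsa'⟩,
        lt_of_le_of_ne h2 (hne (Or.inl rfl)).symm, lt_of_le_of_ne h4 (hne (Or.inr rfl))⟩)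
    (fun z hz h0 => hdet z hz (Prod.mk_eq_zero.1 h0).1 (Prod.mk_eq_zero.1 h0).2) Z
    (fun z => by rw [hZ, Prod.mk_eq_zero])
  obtain ⟨b, β, hbd, hb, hb0, hb1, hβ, hβn, hβ0⟩ := exists_bump (lt_min hδ₁ (lt_min hδ₂ hδ₃))
  have e := h₃ (fun y => b y.1 * b y.2) (by have := hbd.continuous; fun_prop) fun y hy => by
    rw [Prod.norm_def, le_max_iff, Real.norm_eq_abs, Real.norm_eq_abs] at hy
    have hm : ∀ {x}, δ₃ ≤ |x| → b x = 0 := fun hx =>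
      hb0 _ ((min_le_right _ _).trans ((min_le_right _ _).trans hx))
    rcases hy with hy | hy
    · rw [hm hy, zero_mul]
    · rw [hm hy, mul_zero]
  rw [Measure.volume_eq_prod, integral_prod_mul (fun x => b x) (fun x => b x), hb1, mul_one, mul_one]
    at e
  rw [← e, ← Measure.volume_eq_prod, integral_pullback_rect hF hG hFp hGp hbd hβ hcd.le]
  have hm₂ : min δ₁ (min δ₂ δ₃) ≤ δ₂ := (min_le_right _ _).trans (min_le_left _ _)
  have i₁ := h₁ b β hb (fun x hx => hb0 x ((min_le_left _ _).trans hx)) hβn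
    fun x hx => hβ0 x (hx.trans (neg_le_neg (min_le_left _ _)))
  have i₂ := h₂ b β hb (fun x hx => hb0 x (hm₂.trans hx)) hβn
    fun x hx => hβ0 x (hx.trans (neg_le_neg hm₂))
  simp only [Pi.neg_apply, mul_neg, intervalIntegral.integral_neg] at i₂
  linarith

end Degree

/-! ### The chord map of a closed plane curve -/

/-- The determinant of the chord from parameter `s` to parameter `s + r` of the curve `(u, v)`
with the velocity at its initial point. -/
def initDet (u v : ℝ → ℝ) (z : ℝ × ℝ) : ℝ :=
  (u (z.1 + z.2) - u z.1) * deriv v z.1 - (v (z.1 + z.2) - v z.1) * deriv u z.1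

/-- The determinant of the chord from parameter `s` to parameter `s + r` of the curve `(u, v)`
with the velocity at its final point. -/
def finDet (u v : ℝ → ℝ) (z : ℝ × ℝ) : ℝ :=
  (u (z.1 + z.2) - u z.1) * deriv v (z.1 + z.2) - (v (z.1 + z.2) - v z.1) * deriv u (z.1 + z.2)

/-- The unnormalized signed curvature of the curve `(u, v)`. -/
def curvDet (u v : ℝ → ℝ) (t : ℝ) : ℝ :=
  deriv u t * deriv (deriv v) t - deriv v t * deriv (deriv u) t

section Chord

variable {u v : ℝ → ℝ}

lemma contDiff_deriv_of_three (hu : ContDiff ℝ 3 u) : ContDiff ℝ 2 (deriv u) :=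
  ((contDiff_succ_iff_deriv (n := 2)).1 hu).2.2

lemma hasDerivAt_deriv_of_three (hu : ContDiff ℝ 3 u) (x : ℝ) : HasDerivAt u (deriv u x) x :=
  (hu.differentiable (by norm_num) x).hasDerivAt

lemma hasDerivAt_deriv_deriv_of_three (hu : ContDiff ℝ 3 u) (x : ℝ) :
    HasDerivAt (deriv u) (deriv (deriv u) x) x :=
  ((contDiff_deriv_of_three hu).differentiable (by norm_num) x).hasDerivAt

lemma continuous_curvDet (hu : ContDiff ℝ 3 u) (hv : ContDiff ℝ 3 v) :
    Continuous (curvDet u v) := by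
  have h2 : ∀ {f : ℝ → ℝ}, ContDiff ℝ 3 f → Continuous (deriv (deriv f)) := fun hf =>
    (contDiff_deriv_of_three hf).continuous_deriv (by norm_num)
  exact ((contDiff_deriv_of_three hu).continuous.mul (h2 hv)).sub
    ((contDiff_deriv_of_three hv).continuous.mul (h2 hu))

lemma contDiff_initDet (hu : ContDiff ℝ 3 u) (hv : ContDiff ℝ 3 v) :
    ContDiff ℝ 2 (initDet u v) := by
  have hu1 := contDiff_deriv_of_three hu
  have hv1 := contDiff_deriv_of_three hv
  have hu' : ContDiff ℝ 2 u := hu.of_le (by norm_num)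
  have hv' : ContDiff ℝ 2 v := hv.of_le (by norm_num)
  unfold initDet
  fun_prop

lemma contDiff_finDet (hu : ContDiff ℝ 3 u) (hv : ContDiff ℝ 3 v) :
    ContDiff ℝ 2 (finDet u v) := by
  have hu1 := contDiff_deriv_of_three hu
  have hv1 := contDiff_deriv_of_three hv
  have hu' : ContDiff ℝ 2 u := hu.of_le (by norm_num)
  have hv' : ContDiff ℝ 2 v := hv.of_le (by norm_num)
  unfold finDet
  fun_prop

lemma fderiv_apply_fst {F : ℝ × ℝ → ℝ} (hF : ContDiff ℝ 2 F) {s r e : ℝ}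
    (h : HasDerivAt (fun x => F (x, r)) e s) : fderiv ℝ F (s, r) (1, 0) = e :=
  (HasFDerivAt.comp_hasDerivAt s (hF.differentiable (by norm_num) (s, r)).hasFDerivAt
    ((hasDerivAt_id s).prodMk (hasDerivAt_const s r))).unique h

lemma fderiv_apply_snd {F : ℝ × ℝ → ℝ} (hF : ContDiff ℝ 2 F) {s r e : ℝ}
    (h : HasDerivAt (fun x => F (s, x)) e r) : fderiv ℝ F (s, r) (0, 1) = e :=
  (HasFDerivAt.comp_hasDerivAt r (hF.differentiable (by norm_num) (s, r)).hasFDerivAt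
    ((hasDerivAt_const r s).prodMk (hasDerivAt_id r))).unique h

lemma fderiv_initDet_fst (hu : ContDiff ℝ 3 u) (hv : ContDiff ℝ 3 v) (s r : ℝ) :
    fderiv ℝ (initDet u v) (s, r) (1, 0) =
      (deriv u (s + r) - deriv u s) * deriv v s + (u (s + r) - u s) * deriv (deriv v) s -
        (deriv v (s + r) - deriv v s) * deriv u s - (v (s + r) - v s) * deriv (deriv u) s := by
  refine fderiv_apply_fst (contDiff_initDet hu hv) ?_
  have d1 := hasDerivAt_deriv_of_three hu
  have e1 := hasDerivAt_deriv_of_three hv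
  have d2 := hasDerivAt_deriv_deriv_of_three hu
  have e2 := hasDerivAt_deriv_deriv_of_three hv
  refine (((((d1 (s + r)).comp_add_const s r).sub (d1 s)).mul (e2 s)).sub
    ((((e1 (s + r)).comp_add_const s r).sub (e1 s)).mul (d2 s))).congr_deriv ?_
  simp only [Pi.sub_apply]
  ring

lemma fderiv_initDet_snd (hu : ContDiff ℝ 3 u) (hv : ContDiff ℝ 3 v) (s r : ℝ) :
    fderiv ℝ (initDet u v) (s, r) (0, 1) =
      deriv u (s + r) * deriv v s - deriv v (s + r) * deriv u s := by
  refine fderiv_apply_snd (contDiff_initDet hu hv) ?_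
  have d1 := hasDerivAt_deriv_of_three hu
  have e1 := hasDerivAt_deriv_of_three hv
  exact ((((d1 (s + r)).comp_const_add s r).sub_const (u s)).mul_const (deriv v s)).sub
    ((((e1 (s + r)).comp_const_add s r).sub_const (v s)).mul_const (deriv u s))

lemma fderiv_finDet_fst (hu : ContDiff ℝ 3 u) (hv : ContDiff ℝ 3 v) (s r : ℝ) :
    fderiv ℝ (finDet u v) (s, r) (1, 0) =
      (deriv u (s + r) - deriv u s) * deriv v (s + r) +
        (u (s + r) - u s) * deriv (deriv v) (s + r) -
        (deriv v (s + r) - deriv v s) * deriv u (s + r) -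
        (v (s + r) - v s) * deriv (deriv u) (s + r) := by
  refine fderiv_apply_fst (contDiff_finDet hu hv) ?_
  have d1 := hasDerivAt_deriv_of_three hu
  have e1 := hasDerivAt_deriv_of_three hv
  have d2 := hasDerivAt_deriv_deriv_of_three hu
  have e2 := hasDerivAt_deriv_deriv_of_three hv
  refine (((((d1 (s + r)).comp_add_const s r).sub (d1 s)).mul
    ((e2 (s + r)).comp_add_const s r)).sub
    ((((e1 (s + r)).comp_add_const s r).sub (e1 s)).mul
      ((d2 (s + r)).comp_add_const s r))).congr_deriv ?_
  simp only [Pi.sub_apply]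
  ring

lemma fderiv_finDet_snd (hu : ContDiff ℝ 3 u) (hv : ContDiff ℝ 3 v) (s r : ℝ) :
    fderiv ℝ (finDet u v) (s, r) (0, 1) =
      (u (s + r) - u s) * deriv (deriv v) (s + r) -
        (v (s + r) - v s) * deriv (deriv u) (s + r) := by
  refine fderiv_apply_snd (contDiff_finDet hu hv) ?_
  have d1 := hasDerivAt_deriv_of_three hu
  have e1 := hasDerivAt_deriv_of_three hv
  have d2 := hasDerivAt_deriv_deriv_of_three hu
  have e2 := hasDerivAt_deriv_deriv_of_three hv
  refine (((((d1 (s + r)).comp_const_add s r).sub_const (u s)).mul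
    ((e2 (s + r)).comp_const_add s r)).sub
    ((((e1 (s + r)).comp_const_add s r).sub_const (v s)).mul
      ((d2 (s + r)).comp_const_add s r))).congr_deriv ?_
  ring

/-- The Jacobian of the map given by the two chord determinants. -/
lemma det_chordMap (hu : ContDiff ℝ 3 u) (hv : ContDiff ℝ 3 v) (s r : ℝ) :
    (fderiv ℝ (fun z => (initDet u v z, finDet u v z)) (s, r)).det =
      ((u (s + r) - u s) * deriv (deriv v) s - (v (s + r) - v s) * deriv (deriv u) s) *
        ((u (s + r) - u s) * deriv (deriv v) (s + r) -
          (v (s + r) - v s) * deriv (deriv u) (s + r)) -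
        (deriv u s * deriv v (s + r) - deriv v s * deriv u (s + r)) ^ 2 := by
  have h : fderiv ℝ (fun z => (initDet u v z, finDet u v z)) (s, r) =
      (fderiv ℝ (initDet u v) (s, r)).prod (fderiv ℝ (finDet u v) (s, r)) :=
    ((((contDiff_initDet hu hv).differentiable (by norm_num)) (s, r)).hasFDerivAt.prodMk
      (((contDiff_finDet hu hv).differentiable (by norm_num)) (s, r)).hasFDerivAt).fderiv
  rw [h, det_prod_apply, fderiv_initDet_fst hu hv, fderiv_initDet_snd hu hv,
    fderiv_finDet_fst hu hv, fderiv_finDet_snd hu hv]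
  ring

lemma periodic_deriv {E : Type*} [NormedAddCommGroup E] [NormedSpace ℝ E] {f : ℝ → E}
    {c : ℝ} (hf : Function.Periodic f c) :
    Function.Periodic (deriv f) c := by
  intro x
  rw [← deriv_comp_add_const, hf.funext]

lemma map_fract_of_periodic {α : Type*} {f : ℝ → α} (hf : Function.Periodic f 1) (x : ℝ) :
    f (Int.fract x) = f x := by
  have := hf.sub_int_mul_eq (x := x) ⌊x⌋
  rwa [mul_one] at this

/-- Nearby points of a finite union of integer translates coincide. -/
lemma exists_separation {p : ℝ → Prop} (hp : ∀ x, p (x + 1) ↔ p x)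
    (hfin : {t | t ∈ Ico (0 : ℝ) 1 ∧ p t}.Finite) :
    ∃ ε > 0, ∀ x y, p x → p y → |x - y| < ε → x = y := by
  have hper : Function.Periodic p 1 := fun x => propext (hp x)
  set A := {t | t ∈ Ico (0 : ℝ) 1 ∧ p t}
  have hB : (A ∪ (fun x => x + 1) '' A ∪ (fun x => x - 1) '' A).Finite :=
    (hfin.union (hfin.image _)).union (hfin.image _)
  set B := A ∪ (fun x => x + 1) '' A ∪ (fun x => x - 1) '' A
  have hD : (image2 (fun x y => x - y) B B \ {0}).Finite := (hB.image2 _ hB).sdiff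
  obtain ⟨ε, hε, hball⟩ := Metric.mem_nhds_iff.1
    (hD.isClosed.isOpen_compl.mem_nhds (fun h => h.2 rfl :
      (0 : ℝ) ∈ (image2 (fun x y => x - y) B B \ {0})ᶜ))
  refine ⟨min ε 1, lt_min hε one_pos, fun x y hx hy hxy => ?_⟩
  obtain ⟨h1, h2⟩ := lt_min_iff.1 hxy
  by_contra hne
  have hmem : x - y ∈ Metric.ball (0 : ℝ) ε := by simpa using h1
  refine hball hmem ⟨⟨x - ⌊x⌋, Or.inl (Or.inl ⟨⟨Int.fract_nonneg x, Int.fract_lt_one x⟩, ?_⟩),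
    y - ⌊x⌋, ?_, by ring⟩, sub_ne_zero.2 hne⟩
  · exact (map_fract_of_periodic hper x).symm ▸ hx
  have hyp : p (Int.fract y) := (map_fract_of_periodic hper y).symm ▸ hy
  have hyA : Int.fract y ∈ A := ⟨⟨Int.fract_nonneg y, Int.fract_lt_one y⟩, hyp⟩
  have hfloor : ⌊y⌋ = ⌊x⌋ ∨ ⌊y⌋ = ⌊x⌋ + 1 ∨ ⌊y⌋ = ⌊x⌋ - 1 := by
    have a1 := Int.floor_le x
    have a2 := Int.lt_floor_add_one x
    have b1 := Int.floor_le y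
    have b2 := Int.lt_floor_add_one y
    rw [abs_lt] at h2
    have l1 : ⌊y⌋ < ⌊x⌋ + 2 := by
      have : (⌊y⌋ : ℝ) < ⌊x⌋ + 2 := by linarith
      exact_mod_cast this
    have l2 : ⌊x⌋ < ⌊y⌋ + 2 := by
      have : (⌊x⌋ : ℝ) < ⌊y⌋ + 2 := by linarith
      exact_mod_cast this
    omega
  have hy' : y = ⌊y⌋ + Int.fract y := (Int.floor_add_fract y).symm
  rcases hfloor with h | h | h
  · exact Or.inl (Or.inl (h ▸ hyA))
  · refine Or.inl (Or.inr ⟨_, hyA, ?_⟩)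
    have : (⌊y⌋ : ℝ) = ⌊x⌋ + 1 := by exact_mod_cast h
    simp only
    linarith
  · refine Or.inr ⟨_, hyA, ?_⟩
    have : (⌊y⌋ : ℝ) = ⌊x⌋ - 1 := by exact_mod_cast h
    simp only
    linarith

/-- A closed immersed curve with finitely many inflection points has a scale below which arcs turn
by less than a right angle and have at most one inflection point. -/
lemma exists_scale (hu : ContDiff ℝ 3 u) (hv : ContDiff ℝ 3 v) (hup : Function.Periodic u 1)
    (hvp : Function.Periodic v 1) (himm : ∀ t, 0 < deriv u t * deriv u t + deriv v t * deriv v t)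
    (hinfl : {t | t ∈ Ico (0 : ℝ) 1 ∧ curvDet u v t = 0}.Finite) :
    ∃ ε, 0 < ε ∧ ε < 1 / 2 ∧
      (∀ s t, |t - s| ≤ ε → 0 < deriv u s * deriv u t + deriv v s * deriv v t) ∧
      ∀ x y, curvDet u v x = 0 → curvDet u v y = 0 → |x - y| ≤ ε → x = y := by
  have hu1 : Continuous (deriv u) := (contDiff_deriv_of_three hu).continuous
  have hv1 : Continuous (deriv v) := (contDiff_deriv_of_three hv).continuous
  have hu1p := periodic_deriv hup
  have hv1p := periodic_deriv hvp
  obtain ⟨ε₁, hε₁, h₁⟩ := exists_separation (p := fun t => curvDet u v t = 0) (fun x => by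
    simp only [curvDet, hu1p x, hv1p x, periodic_deriv hu1p x, periodic_deriv hv1p x]) hinfl
  have hopen : IsOpen {p : ℝ × ℝ | 0 < deriv u p.1 * deriv u (p.1 + p.2) +
      deriv v p.1 * deriv v (p.1 + p.2)} := isOpen_lt continuous_const (by fun_prop)
  obtain ⟨U, V, -, hV, hIU, h0V, hUV⟩ := generalized_tube_lemma (s := Icc (0 : ℝ) 1) isCompact_Icc
    (t := {(0 : ℝ)}) isCompact_singleton hopen (by
      rintro ⟨s, r⟩ ⟨-, hr⟩
      obtain rfl : r = 0 := hr
      simpa using himm s)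
  obtain ⟨ε₂, hε₂, h₂⟩ := Metric.isOpen_iff.1 hV 0 (h0V rfl)
  have hε : 0 < min ε₁ (min ε₂ (1 / 2)) := lt_min hε₁ (lt_min hε₂ (by norm_num))
  have hlt := half_lt_self hε
  obtain ⟨l1, l2, l3⟩ : _ ∧ _ ∧ _ := by simpa only [lt_min_iff] using hlt
  refine ⟨min ε₁ (min ε₂ (1 / 2)) / 2, half_pos hε, l3, fun s t hst => ?_, fun x y hx hy hxy =>
    h₁ x y hx hy (hxy.trans_lt l1)⟩
  have hm : t - s ∈ Metric.ball (0 : ℝ) ε₂ := by simpa using hst.trans_lt l2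
  have := hUV (mk_mem_prod (hIU ⟨Int.fract_nonneg s, (Int.fract_lt_one s).le⟩) (h₂ hm))
  have ht : Int.fract s + (t - s) = t - ⌊s⌋ * 1 := by
    rw [Int.fract]
    ring
  simpa only [mem_ofPred_eq, ht, hu1p.sub_int_mul_eq, hv1p.sub_int_mul_eq,
    map_fract_of_periodic hu1p, map_fract_of_periodic hv1p] using this

/-- At a scale below which arcs turn by less than a right angle and have at most one inflection
point, a chord in the direction of the initial velocity turns counterclockwise relative to it
exactly when the final determinant is positive. -/
lemma initDet_eq_zero_of_short (hu : ContDiff ℝ 3 u) (hv : ContDiff ℝ 3 v) {ε : ℝ}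
    (hdot : ∀ s t, |t - s| ≤ ε → 0 < deriv u s * deriv u t + deriv v s * deriv v t)
    (huniq : ∀ x y, curvDet u v x = 0 → curvDet u v y = 0 → |x - y| ≤ ε → x = y)
    {s r : ℝ} (hr : 0 < r) (hrε : r ≤ ε) (hz : initDet u v (s, r) = 0) :
    finDet u v (s, r) * fderiv ℝ (initDet u v) (s, r) (1, 0) < 0 := by
  rw [fderiv_initDet_fst hu hv]
  refine chord_initial_tangent (s := s) (t := s + r) (hasDerivAt_deriv_of_three hu)
    (hasDerivAt_deriv_deriv_of_three hu) (hasDerivAt_deriv_of_three hv)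
    (hasDerivAt_deriv_deriv_of_three hv) (continuous_curvDet hu hv) (by linarith)
    (fun x hx => hdot s x ?_) (fun x hx y hy h1 h2 => huniq x y h1 h2 ?_) hz
  · rw [abs_le]
    constructor <;> linarith [hx.1, hx.2]
  · rw [abs_le]
    constructor <;> linarith [hx.1, hx.2, hy.1, hy.2]

lemma finDet_eq_zero_of_short (hu : ContDiff ℝ 3 u) (hv : ContDiff ℝ 3 v) {ε : ℝ}
    (hdot : ∀ s t, |t - s| ≤ ε → 0 < deriv u s * deriv u t + deriv v s * deriv v t)
    (huniq : ∀ x y, curvDet u v x = 0 → curvDet u v y = 0 → |x - y| ≤ ε → x = y)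
    {s r : ℝ} (hr : 0 < r) (hrε : r ≤ ε) (hz : finDet u v (s, r) = 0) :
    0 < initDet u v (s, r) * fderiv ℝ (finDet u v) (s, r) (1, 0) := by
  rw [fderiv_finDet_fst hu hv]
  refine chord_final_tangent (s := s) (t := s + r) (hasDerivAt_deriv_of_three hu)
    (hasDerivAt_deriv_deriv_of_three hu) (hasDerivAt_deriv_of_three hv)
    (hasDerivAt_deriv_deriv_of_three hv) (continuous_curvDet hu hv) (by linarith)
    (fun x hx => hdot (s + r) x ?_) (fun x hx y hy h1 h2 => huniq x y h1 h2 ?_) hz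
  · rw [abs_le]
    constructor <;> linarith [hx.1, hx.2]
  · rw [abs_le]
    constructor <;> linarith [hx.1, hx.2, hy.1, hy.2]

lemma initDet_add_one (hup : Function.Periodic u 1) (hvp : Function.Periodic v 1) (s r : ℝ) :
    initDet u v (s + 1, r) = initDet u v (s, r) := by
  simp only [initDet, add_right_comm s 1 r, hup _, hvp _, periodic_deriv hup _,
    periodic_deriv hvp _]

lemma finDet_add_one (hup : Function.Periodic u 1) (hvp : Function.Periodic v 1) (s r : ℝ) :
    finDet u v (s + 1, r) = finDet u v (s, r) := by
  simp only [finDet, add_right_comm s 1 r, hup _, hvp _, periodic_deriv hup _,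
    periodic_deriv hvp _]

lemma initDet_one_sub (hup : Function.Periodic u 1) (hvp : Function.Periodic v 1) (s r : ℝ) :
    initDet u v (s, 1 - r) = -finDet u v (s - r, r) := by
  have h : s + (1 - r) = s - r + 1 := by ring
  simp only [initDet, finDet, h, hup (s - r), hvp (s - r), sub_add_cancel]
  ring

lemma finDet_one_sub (hup : Function.Periodic u 1) (hvp : Function.Periodic v 1) (s r : ℝ) :
    finDet u v (s, 1 - r) = -initDet u v (s - r, r) := by
  have h : s + (1 - r) = s - r + 1 := by ring
  simp only [initDet, finDet, h, hup (s - r), hvp (s - r), periodic_deriv hup (s - r),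
    periodic_deriv hvp (s - r), sub_add_cancel]
  ring

lemma fderiv_finDet_one_sub (hu : ContDiff ℝ 3 u) (hv : ContDiff ℝ 3 v)
    (hup : Function.Periodic u 1) (hvp : Function.Periodic v 1) (s r : ℝ) :
    fderiv ℝ (finDet u v) (s, 1 - r) (1, 0) = -fderiv ℝ (initDet u v) (s - r, r) (1, 0) := by
  have h : s + (1 - r) = s - r + 1 := by ring
  have hup1 := periodic_deriv hup
  have hvp1 := periodic_deriv hvp
  simp only [fderiv_finDet_fst hu hv, fderiv_initDet_fst hu hv, h, hup (s - r), hvp (s - r),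
    hup1 (s - r), hvp1 (s - r), periodic_deriv hup1 (s - r), periodic_deriv hvp1 (s - r),
    sub_add_cancel]
  ring

/-- On a closed immersed plane curve with finitely many inflection points whose crossings are
transverse and whose double tangencies are nondegenerate, at most half of the common zeros of the
two chord determinants come from crossings. -/
lemma exists_zeros_chordMap (hu : ContDiff ℝ 3 u) (hv : ContDiff ℝ 3 v)
    (hup : Function.Periodic u 1) (hvp : Function.Periodic v 1)
    (himm : ∀ t, 0 < deriv u t * deriv u t + deriv v t * deriv v t)
    (hinfl : {t | t ∈ Ico (0 : ℝ) 1 ∧ curvDet u v t = 0}.Finite)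
    (hcross : ∀ s, ∀ r ∈ Ioo (0 : ℝ) 1, u (s + r) = u s → v (s + r) = v s →
      deriv u s * deriv v (s + r) - deriv v s * deriv u (s + r) ≠ 0)
    (hbit : ∀ s, ∀ r ∈ Ioo (0 : ℝ) 1, initDet u v (s, r) = 0 → finDet u v (s, r) = 0 →
      ¬ (u (s + r) = u s ∧ v (s + r) = v s) →
      (u (s + r) - u s) * deriv (deriv v) s - (v (s + r) - v s) * deriv (deriv u) s ≠ 0 ∧
      (u (s + r) - u s) * deriv (deriv v) (s + r) -
        (v (s + r) - v s) * deriv (deriv u) (s + r) ≠ 0) :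
    ∃ a, ∃ Z : Finset (ℝ × ℝ),
      (∀ s r, (s, r) ∈ Z ↔ s ∈ Ico a (a + 1) ∧ r ∈ Ioo (0 : ℝ) 1 ∧
        initDet u v (s, r) = 0 ∧ finDet u v (s, r) = 0) ∧
      (Z.filter fun z => u (z.1 + z.2) = u z.1 ∧ v (z.1 + z.2) = v z.1).card ≤
        (Z.filter fun z => ¬ (u (z.1 + z.2) = u z.1 ∧ v (z.1 + z.2) = v z.1)).card := by
  obtain ⟨ε, hε, hε2, hdot, huniq⟩ := exists_scale hu hv hup hvp himm hinfl
  have hF := contDiff_initDet hu hv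
  have hG := contDiff_finDet hu hv
  have hlow : ∀ s r, 0 < r → r ≤ ε → initDet u v (s, r) = 0 → finDet u v (s, r) ≠ 0 := by
    intro s r h0 h1 h2 h3
    have := initDet_eq_zero_of_short hu hv hdot huniq h0 h1 h2
    rw [h3, zero_mul] at this
    exact this.false
  have hmid : ∀ s, ∀ r ∈ Ioo (0 : ℝ) 1, initDet u v (s, r) = 0 → finDet u v (s, r) = 0 →
      r ∈ Icc ε (1 - ε) := by
    intro s r hr h1 h2
    constructor
    · by_contra! h
      exact hlow s r hr.1 h.le h1 h2
    · by_contra! h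
      have e1 := initDet_one_sub hup hvp s (1 - r)
      have e2 := finDet_one_sub hup hvp s (1 - r)
      rw [sub_sub_cancel] at e1 e2
      exact hlow (s - (1 - r)) (1 - r) (by linarith [hr.2]) (by linarith) (by linarith)
        (by linarith)
  have hIoo : ∀ {r}, r ∈ Icc ε (1 - ε) → r ∈ Ioo (0 : ℝ) 1 := fun hr =>
    ⟨hε.trans_le hr.1, by linarith [hr.2]⟩
  -- The sign of the Jacobian at the zeros.
  have hsign : ∀ s, ∀ r ∈ Ioo (0 : ℝ) 1, initDet u v (s, r) = 0 → finDet u v (s, r) = 0 →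
      (fderiv ℝ (fun z => (initDet u v z, finDet u v z)) (s, r)).det ≠ 0 ∧
      (u (s + r) = u s ∧ v (s + r) = v s →
        (fderiv ℝ (fun z => (initDet u v z, finDet u v z)) (s, r)).det < 0) := by
    intro s r hr h1 h2
    rw [det_chordMap hu hv]
    by_cases hw : u (s + r) = u s ∧ v (s + r) = v s
    · have := pow_pos (abs_pos.2 (hcross s r hr hw.1 hw.2)) 2
      rw [sq_abs] at this
      have h3 : ((u (s + r) - u s) * deriv (deriv v) s - (v (s + r) - v s) * deriv (deriv u) s) *
          ((u (s + r) - u s) * deriv (deriv v) (s + r) -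
          (v (s + r) - v s) * deriv (deriv u) (s + r)) -
          (deriv u s * deriv v (s + r) - deriv v s * deriv u (s + r)) ^ 2 < 0 := by
        simpa [hw.1, hw.2] using this
      exact ⟨h3.ne, fun _ => h3⟩
    · refine ⟨?_, fun h => (hw h).elim⟩
      obtain ⟨hA, hB⟩ := hbit s r hr h1 h2 hw
      have hc : deriv u s * deriv v (s + r) - deriv v s * deriv u (s + r) = 0 := by
        simp only [initDet, finDet] at h1 h2
        have k1 : (u (s + r) - u s) * (deriv u s * deriv v (s + r) - deriv v s * deriv u (s + r))
            = 0 := by linear_combination deriv u s * h2 - deriv u (s + r) * h1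
        have k2 : (v (s + r) - v s) * (deriv u s * deriv v (s + r) - deriv v s * deriv u (s + r))
            = 0 := by linear_combination deriv v s * h2 - deriv v (s + r) * h1
        by_contra hne
        exact hw ⟨sub_eq_zero.1 ((mul_eq_zero.1 k1).resolve_right hne),
          sub_eq_zero.1 ((mul_eq_zero.1 k2).resolve_right hne)⟩
      rw [hc]
      simpa using And.intro hA hB
  -- A first parameter that is avoided by the zeros.
  have hΦ : ContDiff ℝ 1 fun z => (initDet u v z, finDet u v z) :=
    (hF.prodMk hG).of_le (by norm_num)
  have hfin : ∀ a, {z | z ∈ Icc (a, ε) (a + 1, 1 - ε) ∧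
      (initDet u v z, finDet u v z) = 0}.Finite := fun a =>
    finite_zeros hΦ isCompact_Icc fun z hz h0 =>
      (hsign z.1 z.2 (hIoo ⟨hz.1.2, hz.2.2⟩) (Prod.mk.inj h0).1 (Prod.mk.inj h0).2).1
  obtain ⟨a, ha, ha'⟩ := (Ioo_infinite (zero_lt_one (α := ℝ))).exists_notMem_finite
    ((hfin 0).image Prod.fst)
  have hside : ∀ r ∈ Icc ε (1 - ε), initDet u v (a, r) = 0 → finDet u v (a, r) ≠ 0 := by
    intro r hr h1 h2
    refine ha' ⟨(a, r), ⟨⟨⟨ha.1.le, hr.1⟩, ⟨by simpa using ha.2.le, hr.2⟩⟩, ?_⟩, rfl⟩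
    rw [h1, h2]
    rfl
  set Z := (hfin a).toFinset with hZdef
  have hZ : ∀ z, z ∈ Z ↔ z ∈ Icc (a, ε) (a + 1, 1 - ε) ∧ initDet u v z = 0 ∧
      finDet u v z = 0 := by
    intro z
    rw [hZdef, Finite.mem_toFinset]
    exact and_congr_right fun _ => Prod.mk_inj
  have hsum := sum_sign_det_nonneg hF hG (initDet_add_one hup hvp) (finDet_add_one hup hvp)
    (a := a) (c := ε) (d := 1 - ε) (by linarith)
    (fun s hs => finDet_eq_zero_of_short hu hv hdot huniq hε le_rfl hs)
    (fun s hs => by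
      rw [initDet_one_sub hup hvp, fderiv_finDet_one_sub hu hv hup hvp, neg_mul_neg]
      rw [finDet_one_sub hup hvp, neg_eq_zero] at hs
      exact initDet_eq_zero_of_short hu hv hdot huniq hε le_rfl hs)
    hside (fun z hz h1 h2 => (hsign z.1 z.2 (hIoo ⟨hz.1.2, hz.2.2⟩) h1 h2).1) Z hZ
  refine ⟨a, Z, fun s r => ?_, ?_⟩
  · rw [hZ]
    constructor
    · rintro ⟨⟨⟨l1, l2⟩, l3, l4⟩, h1, h2⟩
      refine ⟨⟨l1, lt_of_le_of_ne l3 ?_⟩, hIoo ⟨l2, l4⟩, h1, h2⟩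
      rintro rfl
      rw [initDet_add_one hup hvp] at h1
      rw [finDet_add_one hup hvp] at h2
      exact hside r ⟨l2, l4⟩ h1 h2
    · rintro ⟨hs, hr, h1, h2⟩
      have := hmid s r hr h1 h2
      exact ⟨⟨⟨hs.1, this.1⟩, hs.2.le, this.2⟩, h1, h2⟩
  · have key : ∀ z ∈ Z,
        ((SignType.sign (fderiv ℝ (fun z => (initDet u v z, finDet u v z)) z).det : SignType) : ℝ)
          ≤ if u (z.1 + z.2) = u z.1 ∧ v (z.1 + z.2) = v z.1 then -1 else 1 := by
      intro z hz
      obtain ⟨hz1, h1, h2⟩ := (hZ z).1 hz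
      split_ifs with hw
      · rw [sign_neg ((hsign z.1 z.2 (hIoo ⟨hz1.1.2, hz1.2.2⟩) h1 h2).2 hw)]
        simp
      · cases SignType.sign (fderiv ℝ (fun z => (initDet u v z, finDet u v z)) z).det <;> simp
    have := hsum.trans (Finset.sum_le_sum key)
    rw [Finset.sum_ite, Finset.sum_const, Finset.sum_const, nsmul_eq_mul, nsmul_eq_mul] at this
    have h' : ((Z.filter fun z => u (z.1 + z.2) = u z.1 ∧ v (z.1 + z.2) = v z.1).card : ℝ) ≤
        (Z.filter fun z => ¬ (u (z.1 + z.2) = u z.1 ∧ v (z.1 + z.2) = v z.1)).card := by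
      linarith
    exact_mod_cast h'

end Chord

/-! ### Counting crossings and double tangent lines -/

section Counting

variable {c : ℝ → ℝ × ℝ}

lemma deriv_eq_deriv_components (hc : ContDiff ℝ 2 c) (t : ℝ) :
    deriv c t = (deriv (fun x => (c x).1) t, deriv (fun x => (c x).2) t) := by
  have h := (hc.differentiable (by norm_num) t).hasDerivAt
  have h1 : HasDerivAt (fun x => (c x).1) (deriv c t).1 t := h.fst
  have h2 : HasDerivAt (fun x => (c x).2) (deriv c t).2 t := h.snd
  rw [h1.deriv, h2.deriv]

lemma GenericPlane.speed_sq_pos (hg : GenericPlane c) (t : ℝ) :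
    0 < deriv (fun x => (c x).1) t * deriv (fun x => (c x).1) t +
      deriv (fun x => (c x).2) t * deriv (fun x => (c x).2) t := by
  have h := hg.immersed t
  rw [deriv_eq_deriv_components hg.contDiff, Ne, Prod.mk_eq_zero] at h
  by_contra! hle
  exact h ((mul_self_add_mul_self_eq_zero).1
    (hle.antisymm (add_nonneg (mul_self_nonneg _) (mul_self_nonneg _))))

lemma GenericPlane.signedCurv_eq_zero_iff (hg : GenericPlane c) (t : ℝ) :
    signedCurv c t = 0 ↔ curvDet (fun x => (c x).1) (fun x => (c x).2) t = 0 := by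
  have h : speed c t ≠ 0 := by
    refine (Real.sqrt_pos.2 ?_).ne'
    simpa only [sq] using hg.speed_sq_pos t
  rw [signedCurv, div_eq_zero_iff, or_iff_left (pow_ne_zero 3 h), curvDet]

lemma deriv_hFun (hc : ContDiff ℝ 3 c) (L : ℝ × ℝ × ℝ) :
    deriv (hFun c L) =
      fun t => L.1 * deriv (fun x => (c x).1) t + L.2.1 * deriv (fun x => (c x).2) t := by
  ext t
  exact ((((hasDerivAt_deriv_of_three hc.fst t).const_mul L.1).add
    ((hasDerivAt_deriv_of_three hc.snd t).const_mul L.2.1)).sub_const L.2.2).deriv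

lemma deriv_deriv_hFun (hc : ContDiff ℝ 3 c) (L : ℝ × ℝ × ℝ) (t : ℝ) :
    deriv (deriv (hFun c L)) t = L.1 * deriv (deriv fun x => (c x).1) t +
      L.2.1 * deriv (deriv fun x => (c x).2) t := by
  rw [deriv_hFun hc]
  exact (((hasDerivAt_deriv_deriv_of_three hc.fst t).const_mul L.1).add
    ((hasDerivAt_deriv_deriv_of_three hc.snd t).const_mul L.2.1)).deriv

lemma tangentAt_fract (hp : Function.Periodic c 1) {L : ℝ × ℝ × ℝ} {t : ℝ} :
    TangentAt c L (Int.fract t) ↔ TangentAt c L t := by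
  have h : Function.Periodic (hFun c L) 1 := fun x => by simp only [hFun, hp x]
  rw [TangentAt, TangentAt, map_fract_of_periodic hp, map_fract_of_periodic (periodic_deriv h)]

lemma fract_mem_Ico (t : ℝ) : Int.fract t ∈ Ico (0 : ℝ) 1 :=
  ⟨Int.fract_nonneg t, Int.fract_lt_one t⟩

lemma mem_tangencyPts (hp : Function.Periodic c 1) {L : ℝ × ℝ × ℝ} {t : ℝ}
    (h : TangentAt c L t) : c t ∈ tangencyPts c L :=
  ⟨Int.fract t, fract_mem_Ico t, (tangentAt_fract hp).2 h, map_fract_of_periodic hp t⟩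

lemma fract_add_ne_fract (s : ℝ) {r : ℝ} (hr : r ∈ Ioo (0 : ℝ) 1) :
    Int.fract s ≠ Int.fract (s + r) := by
  intro h
  obtain ⟨n, hn⟩ := Int.fract_eq_fract.1 h.symm
  have h0 : (0 : ℝ) < n := by linarith [hr.1]
  have h1 : (n : ℝ) < 1 := by linarith [hr.2]
  have h0' : 0 < n := by exact_mod_cast h0
  have h1' : n < 1 := by exact_mod_cast h1
  omega

lemma eq_of_fract_eq {a s t : ℝ} (hs : s ∈ Ico a (a + 1)) (ht : t ∈ Ico a (a + 1))
    (h : Int.fract s = Int.fract t) : s = t := by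
  obtain ⟨n, hn⟩ := Int.fract_eq_fract.1 h
  have h0 : (-1 : ℝ) < n := by linarith [hs.1, ht.2]
  have h1 : (n : ℝ) < 1 := by linarith [hs.2, ht.1]
  have h0' : -1 < n := by exact_mod_cast h0
  have h1' : n < 1 := by exact_mod_cast h1
  obtain rfl : n = 0 := by omega
  simpa [sub_eq_zero] using hn

lemma exists_lift (a : ℝ) {s t : ℝ} (h : Int.fract s ≠ Int.fract t) :
    ∃ s' ∈ Ico a (a + 1), ∃ r ∈ Ioo (0 : ℝ) 1,
      Int.fract s' = Int.fract s ∧ Int.fract (s' + r) = Int.fract t := by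
  have h1 : Int.fract (s - ⌊s - a⌋) = Int.fract s := Int.fract_sub_intCast _ _
  have h2 : Int.fract (s - ⌊s - a⌋ + Int.fract (t - (s - ⌊s - a⌋))) = Int.fract t := by
    rw [Int.fract_eq_fract]
    exact ⟨-⌊t - (s - ⌊s - a⌋)⌋, by rw [Int.fract]; push_cast; ring⟩
  refine ⟨s - ⌊s - a⌋, ⟨?_, ?_⟩, Int.fract (t - (s - ⌊s - a⌋)),
    ⟨(Int.fract_nonneg _).lt_of_ne fun h0 => ?_, Int.fract_lt_one _⟩, h1, h2⟩
  · linarith [Int.floor_le (s - a)]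
  · linarith [Int.lt_floor_add_one (s - a)]
  · rw [← h0, add_zero, h1] at h2
    exact h h2

lemma crossingPt_of_eq (hp : Function.Periodic c 1) {s t : ℝ}
    (hne : Int.fract s ≠ Int.fract t) (h : c s = c t) : CrossingPt c (c s) :=
  ⟨Int.fract s, fract_mem_Ico s, Int.fract t, fract_mem_Ico t, hne, map_fract_of_periodic hp s,
    (map_fract_of_periodic hp t).trans h.symm⟩

lemma GenericPlane.velocities_independent (hg : GenericPlane c) {s t : ℝ}
    (hne : Int.fract s ≠ Int.fract t) (h : c s = c t) :
    deriv (fun x => (c x).1) s * deriv (fun x => (c x).2) t -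
      deriv (fun x => (c x).2) s * deriv (fun x => (c x).1) t ≠ 0 := by
  have h1 := hg.crossings_transverse _ (fract_mem_Ico s) _ (fract_mem_Ico t) hne (by
    rw [map_fract_of_periodic hg.periodic, map_fract_of_periodic hg.periodic, h])
  have hd := periodic_deriv hg.periodic
  rwa [map_fract_of_periodic hd, map_fract_of_periodic hd, deriv_eq_deriv_components hg.contDiff,
    deriv_eq_deriv_components hg.contDiff] at h1

/-- A line through the endpoints of a proper chord that is tangent to the curve at both of them is
tangent to the curve at both parameters. -/
lemma tangentAt_of_chord (hc : ContDiff ℝ 3 c) {s r : ℝ}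
    (hF : initDet (fun x => (c x).1) (fun x => (c x).2) (s, r) = 0)
    (hG : finDet (fun x => (c x).1) (fun x => (c x).2) (s, r) = 0) (hw : c (s + r) ≠ c s)
    {L : ℝ × ℝ × ℝ} (hL : IsLine L) (hs : c s ∈ lineSet L) (ht : c (s + r) ∈ lineSet L) :
    TangentAt c L s ∧ TangentAt c L (s + r) := by
  have key : ∀ x y : ℝ, ((c (s + r)).1 - (c s).1) * y - ((c (s + r)).2 - (c s).2) * x = 0 →
      L.1 * x + L.2.1 * y = 0 := by
    intro x y h
    have h0 : L.1 * ((c (s + r)).1 - (c s).1) + L.2.1 * ((c (s + r)).2 - (c s).2) = 0 := by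
      simp only [lineSet, mem_ofPred_eq] at hs ht
      linear_combination ht - hs
    have k1 : ((c (s + r)).1 - (c s).1) * (L.1 * x + L.2.1 * y) = 0 := by
      linear_combination x * h0 + L.2.1 * h
    have k2 : ((c (s + r)).2 - (c s).2) * (L.1 * x + L.2.1 * y) = 0 := by
      linear_combination y * h0 - L.1 * h
    by_contra hne
    exact hw (Prod.ext (sub_eq_zero.1 ((mul_eq_zero.1 k1).resolve_right hne))
      (sub_eq_zero.1 ((mul_eq_zero.1 k2).resolve_right hne)))
  refine ⟨⟨hL, hs, ?_⟩, hL, ht, ?_⟩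
  · rw [deriv_hFun hc]
    exact key _ _ hF
  · rw [deriv_hFun hc]
    exact key _ _ hG

/-- The line through two points of the plane. -/
def chordLine (p q : ℝ × ℝ) : ℝ × ℝ × ℝ :=
  (-(q.2 - p.2), q.1 - p.1, -(q.2 - p.2) * p.1 + (q.1 - p.1) * p.2)

lemma isLine_chordLine {p q : ℝ × ℝ} (h : q ≠ p) : IsLine (chordLine p q) := by
  intro h0
  obtain ⟨h1, h2⟩ := Prod.mk.inj h0
  exact h (Prod.ext (sub_eq_zero.1 h2) (sub_eq_zero.1 (neg_eq_zero.1 h1)))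

lemma left_mem_chordLine (p q : ℝ × ℝ) : p ∈ lineSet (chordLine p q) := by
  simp only [lineSet, chordLine, mem_ofPred_eq]

lemma right_mem_chordLine (p q : ℝ × ℝ) : q ∈ lineSet (chordLine p q) := by
  simp only [lineSet, chordLine, mem_ofPred_eq]
  ring

lemma GenericPlane.isDoubleTangent_chordLine (hg : GenericPlane c) (hc : ContDiff ℝ 3 c)
    {s r : ℝ} (hF : initDet (fun x => (c x).1) (fun x => (c x).2) (s, r) = 0)
    (hG : finDet (fun x => (c x).1) (fun x => (c x).2) (s, r) = 0) (hw : c (s + r) ≠ c s) :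
    IsDoubleTangent c (chordLine (c s) (c (s + r))) := by
  have hL := isLine_chordLine hw
  obtain ⟨hs, ht⟩ := tangentAt_of_chord hc hF hG hw hL (left_mem_chordLine _ _)
    (right_mem_chordLine _ _)
  have hs' := mem_tangencyPts hg.periodic hs
  have ht' := mem_tangencyPts hg.periodic ht
  refine ⟨hL, c s, c (s + r), hw.symm, Subset.antisymm (fun p hp => ?_) ?_⟩
  · rcases hg.no_triple_tangent _ hL _ hp _ hs' _ ht' with h | h | h
    · exact Or.inl h
    · exact (hw h.symm).elim
    · exact Or.inr h
  · rintro p (rfl | rfl)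
    exacts [hs', ht']

lemma GenericPlane.fract_eq_of_tangentAt (hg : GenericPlane c) {L : ℝ × ℝ × ℝ}
    (hL : IsDoubleTangent c L) {s t : ℝ} (hs : TangentAt c L s) (h : c s = c t) :
    Int.fract s = Int.fract t := by
  by_contra hne
  exact hg.dbltangent_avoids_crossings L hL _ (crossingPt_of_eq hg.periodic hne h) hs.2.1

/-- A generic closed plane curve of class `C³` has at most as many crossings as double tangent
lines. -/
theorem GenericPlane.crossings_le_double_tangent_lines (hg : GenericPlane c)
    (hc : ContDiff ℝ 3 c) :
    crossingCount c ≤ Nat.card {ℓ : Set (ℝ × ℝ) | IsDoubleTangentLine c ℓ} := by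
  classical
  have hp := hg.periodic
  have hext : ∀ s t, ((c t).1 = (c s).1 ∧ (c t).2 = (c s).2) ↔ c t = c s := fun s t =>
    Prod.ext_iff.symm
  obtain ⟨a, Z, hZ, hle⟩ := exists_zeros_chordMap hc.fst hc.snd
    (fun x => by simp only [hp x]) (fun x => by simp only [hp x]) hg.speed_sq_pos
    (by simpa only [inflectionParams, hg.signedCurv_eq_zero_iff] using hg.inflections_finite)
    (fun s r hr h1 h2 => hg.velocities_independent (fract_add_ne_fract s hr)
      (Prod.ext h1 h2).symm)
    (fun s r hr hF hG hw => by
      rw [hext] at hw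
      have hL := hg.isDoubleTangent_chordLine hc hF hG hw
      obtain ⟨hs, ht⟩ := tangentAt_of_chord hc hF hG hw hL.1 (left_mem_chordLine _ _)
        (right_mem_chordLine _ _)
      have h1 := hg.dbltangent_nondeg _ hL _ hs
      have h2 := hg.dbltangent_nondeg _ hL _ ht
      rw [deriv_deriv_hFun hc] at h1 h2
      simp only [chordLine] at h1 h2
      constructor
      · contrapose! h1
        linear_combination h1
      · contrapose! h2
        linear_combination h2)
  simp only [hext] at hle
  have hC : 2 * hg.selfint_finite.toFinset.card ≤
      (Z.filter fun z => c (z.1 + z.2) = c z.1).card := by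
    refine Finset.mul_card_image_le_card_of_maps_to (f := fun z => c z.1) ?_ 2 ?_
    · rintro ⟨s, r⟩ hz
      rw [Finset.mem_filter, hZ] at hz
      rw [Finite.mem_toFinset]
      exact crossingPt_of_eq hp (fract_add_ne_fract s hz.1.2.1) hz.2.symm
    · intro p hpc
      rw [Finite.mem_toFinset] at hpc
      obtain ⟨s, hs, t, ht, hst, rfl, hct⟩ := hpc
      have hfs : Int.fract s = s := Int.fract_eq_self.2 hs
      have hft : Int.fract t = t := Int.fract_eq_self.2 ht
      have hlift : ∀ x y, x ∈ Ico (0 : ℝ) 1 → y ∈ Ico (0 : ℝ) 1 → x ≠ y → c x = c s → c y = c s →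
          ∃ z ∈ (Z.filter fun z => c (z.1 + z.2) = c z.1).filter fun z => c z.1 = c s,
            Int.fract z.1 = x := by
        intro x y hx hy hxy hcx hcy
        have hfx : Int.fract x = x := Int.fract_eq_self.2 hx
        have hfy : Int.fract y = y := Int.fract_eq_self.2 hy
        obtain ⟨x', hx', r, hr, h1, h2⟩ := exists_lift a (s := x) (t := y) (by rwa [hfx, hfy])
        have e1 : c x' = c s := by
          rw [← map_fract_of_periodic hp x', h1, hfx, hcx]
        have e2 : c (x' + r) = c s := by
          rw [← map_fract_of_periodic hp (x' + r), h2, hfy, hcy]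
        refine ⟨(x', r), ?_, h1.trans hfx⟩
        simp only [Finset.mem_filter, hZ]
        exact ⟨⟨⟨hx', hr, by simp [initDet, e1, e2], by simp [finDet, e1, e2]⟩, e2.trans e1.symm⟩,
          e1⟩
      obtain ⟨z, hz, hzs⟩ := hlift s t hs ht hst rfl hct
      obtain ⟨z', hz', hzt⟩ := hlift t s ht hs hst.symm hct rfl
      refine Finset.one_lt_card.2 ⟨z, hz, z', hz', ?_⟩
      rintro rfl
      exact hst (hzs.symm.trans hzt)
  have hT : (Z.filter fun z => ¬ c (z.1 + z.2) = c z.1).card ≤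
      2 * hg.dbltangents_finite.toFinset.card := by
    refine Finset.card_le_mul_card_image_of_maps_to
      (f := fun z => lineSet (chordLine (c z.1) (c (z.1 + z.2)))) ?_ 2 ?_
    · rintro ⟨s, r⟩ hz
      rw [Finset.mem_filter, hZ] at hz
      rw [Finite.mem_toFinset]
      exact ⟨_, rfl, hg.isDoubleTangent_chordLine hc hz.1.2.2.1 hz.1.2.2.2 hz.2⟩
    · intro ℓ hℓ
      rw [Finite.mem_toFinset] at hℓ
      obtain ⟨L, rfl, hL⟩ := hℓ
      obtain ⟨p, q, -, hpq⟩ := hL.2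
      have hfib : ∀ s r, (s, r) ∈ (Z.filter fun z => ¬ c (z.1 + z.2) = c z.1).filter
          (fun z => lineSet (chordLine (c z.1) (c (z.1 + z.2))) = lineSet L) →
          s ∈ Ico a (a + 1) ∧ r ∈ Ioo (0 : ℝ) 1 ∧ c (s + r) ≠ c s ∧ TangentAt c L s ∧
            TangentAt c L (s + r) := by
        intro s r hz
        simp only [Finset.mem_filter, hZ] at hz
        obtain ⟨⟨⟨hs, hr, hF, hG⟩, hw⟩, hl⟩ := hz
        exact ⟨hs, hr, hw, tangentAt_of_chord hc hF hG hw hL.1 (hl ▸ left_mem_chordLine _ _)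
          (hl ▸ right_mem_chordLine _ _)⟩
      refine (Finset.card_le_card_of_injOn (t := {(p, q), (q, p)})
        (fun z => (c z.1, c (z.1 + z.2))) ?_ ?_).trans Finset.card_le_two
      · rintro ⟨s, r⟩ hz
        obtain ⟨-, -, hw, hs, ht⟩ := hfib s r hz
        have hs' := mem_tangencyPts hp hs
        have ht' := mem_tangencyPts hp ht
        rw [hpq] at hs' ht'
        simp only [Finset.coe_insert, Finset.coe_singleton, mem_insert_iff, mem_singleton_iff,
          Prod.mk.injEq]
        rcases hs' with hs' | hs' <;> rcases ht' with ht' | ht'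
        · exact (hw (ht'.trans hs'.symm)).elim
        · exact Or.inl ⟨hs', ht'⟩
        · exact Or.inr ⟨hs', ht'⟩
        · exact (hw (ht'.trans hs'.symm)).elim
      · rintro ⟨s, r⟩ hz ⟨s', r'⟩ hz' heq
        obtain ⟨hs, hr, -, hst, htt⟩ := hfib s r hz
        obtain ⟨hs', hr', -⟩ := hfib s' r' hz'
        obtain ⟨h1, h2⟩ := Prod.mk.inj heq
        obtain rfl := eq_of_fract_eq hs hs' (hg.fract_eq_of_tangentAt hL hst h1)
        have h3 := hg.fract_eq_of_tangentAt hL htt h2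
        have h4 : s + r = s + r' := eq_of_fract_eq (a := s) ⟨by linarith [hr.1], by linarith [hr.2]⟩
          ⟨by linarith [hr'.1], by linarith [hr'.2]⟩ h3
        rw [add_left_cancel h4]
  rw [crossingCount, Nat.card_coe_set_eq, Nat.card_coe_set_eq,
    ncard_eq_toFinset_card _ hg.selfint_finite, ncard_eq_toFinset_card _ hg.dbltangents_finite]
  omega

end Counting

lemma contDiff_proj {γ : ℝ → ℝ × ℝ × ℝ} (h : ContDiff ℝ (⊤ : ℕ∞) γ) : ContDiff ℝ 3 (proj γ) := by
  have h3 : ContDiff ℝ 3 γ := h.of_le (WithTop.coe_le_coe.2 le_top : ((3 : ℕ∞) : WithTop ℕ∞) ≤ _)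
  exact h3.fst.prodMk h3.snd.fst

/-- For a generic smooth closed curve `γ` in `ℝ³`, the number of crossings of
`π(γ)` is at most the number of double tangent lines of `π(γ)` (the valence-four vertices of
the graphic). -/
theorem crossings_le_double_tangents (γ : ℝ → ℝ × ℝ × ℝ) (h : GenericSpace γ) (c v : ℕ)
    (hc : c = crossingCount (proj γ))
    (hv : v = Nat.card {ℓ : Set (ℝ × ℝ) | IsDoubleTangentLine (proj γ) ℓ}) :
    c ≤ v := by
  rw [hc, hv]
  exact h.2.2.crossings_le_double_tangent_lines (contDiff_proj h.1.1)

end KWidth
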